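/- Let q be a prime power. For every real number u with |u| < 1/q, the series ∑_{n=0}^∞ G_n u^n / |GL(n,q)| converges, the family of factors (1 - u^i q^{1-l})^{-1} indexed by pairs (i,l) with i ≥ 1 and l ≥ 0 is multipliable in ℝ, and ∑_{n=0}^∞ G_n u^n / |GL(n,q)| = ∏_{i ≥ 1} ∏_{l ≥ 0} (1 - u^i q^{1-l})^{-1}. -/

import Mathlib

/-- `|GL(n,q)| = ∏_{i=0}^{n-1} (q^n - q^i)`, as a real number. -/
noncomputable def glOrder (q n : ℕ) : ℝ :=
  ∏ i ∈ Finset.range n, ((q : ℝ) ^ n - (q : ℝ) ^ i)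

/-- `G_n`: the number of ordered pairs of commuting `n × n` matrices over `F`. -/
noncomputable def commPairs (F : Type) [Field F] [Fintype F] (n : ℕ) : ℕ :=
  Nat.card {P : Matrix (Fin n) (Fin n) F × Matrix (Fin n) (Fin n) F //
    P.1 * P.2 = P.2 * P.1}

section
open Module

/-- Number of injective maps. -/
def injN (q n k : ℕ) : ℕ := ∏ i ∈ Finset.range k, (q ^ n - q ^ i)

section part1
variable {F : Type} [Field F] [Fintype F]

lemma finite_of_fd (V : Type) [AddCommGroup V] [Module F V] [FiniteDimensional F V] : Finite V :=
  Module.finite_of_finite F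

lemma card_hom (V W : Type) [AddCommGroup V] [Module F V] [FiniteDimensional F V]
    [AddCommGroup W] [Module F W] [FiniteDimensional F W] :
    Nat.card (V →ₗ[F] W) = Fintype.card F ^ (finrank F V * finrank F W) := by
  rw [Module.natCard_eq_pow_finrank (K := F), Module.finrank_linearMap, Nat.card_eq_fintype_card]

lemma card_inj (W V : Type) [AddCommGroup V] [Module F V] [FiniteDimensional F V]
    [AddCommGroup W] [Module F W] [FiniteDimensional F W] :
    Nat.card {f : W →ₗ[F] V // Function.Injective f} =
      injN (Fintype.card F) (finrank F V) (finrank F W) := by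
  have := finite_of_fd (F := F) V
  let b := Module.finBasis F W
  have e : {f : W →ₗ[F] V // Function.Injective f} ≃
      { s : Fin (finrank F W) → V // LinearIndependent F s } := by
    refine (b.constr F).symm.toEquiv.subtypeEquiv ?_
    intro f
    have : (b.constr F).symm.toEquiv f = f ∘ b := by
      ext i; simp [Basis.constr]
    rw [this]
    constructor
    · intro h
      exact b.linearIndependent.map' f (LinearMap.ker_eq_bot.2 h)
    · intro h
      rw [← LinearMap.ker_eq_bot]
      have h1 : finrank F (LinearMap.range f) = finrank F W := by
        have h2 : LinearMap.range f = Submodule.span F (Set.range (f ∘ b)) := by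
          rw [Set.range_comp, ← Submodule.map_span, b.span_eq, Submodule.map_top]
        rw [h2, finrank_span_eq_card h, Fintype.card_fin]
      have := f.finrank_range_add_finrank_ker
      rw [h1] at this
      exact Submodule.finrank_eq_zero.1 (by omega)
  by_cases hk : finrank F W ≤ finrank F V
  · rw [Nat.card_congr e, card_linearIndependent hk, injN, Finset.prod_range]
  · have : IsEmpty {f : W →ₗ[F] V // Function.Injective f} := by
      refine ⟨fun f => hk ?_⟩
      exact LinearMap.finrank_le_finrank_of_injective f.2
    rw [Nat.card_of_isEmpty]
    symm
    rw [injN]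
    apply Finset.prod_eq_zero (i := finrank F V) (by simpa using hk)
    simp

lemma card_surj (W V : Type) [AddCommGroup V] [Module F V] [FiniteDimensional F V]
    [AddCommGroup W] [Module F W] [FiniteDimensional F W] :
    Nat.card {f : W →ₗ[F] V // Function.Surjective f} =
      injN (Fintype.card F) (finrank F W) (finrank F V) := by
  have := card_inj (F := F) (Dual F V) (Dual F W)
  rw [Subspace.dual_finrank_eq, Subspace.dual_finrank_eq] at this
  rw [← this]
  apply Nat.card_congr
  refine Equiv.subtypeEquiv (Equiv.ofBijective (fun f : W →ₗ[F] V => f.dualMap) ?_) ?_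
  · have := finite_of_fd (F := F) (Dual F V →ₗ[F] Dual F W)
    apply Function.Injective.bijective_of_nat_card_le
    · intro f g h
      ext x
      rw [← sub_eq_zero, ← Module.forall_dual_apply_eq_zero_iff F]
      intro φ
      have := congrArg (fun k => k φ x) h
      simp at this
      simp [this]
    · rw [card_hom, card_hom, Subspace.dual_finrank_eq, Subspace.dual_finrank_eq, mul_comm]
  · intro f
    exact LinearMap.dualMap_injective_iff.symm

lemma card_equivs (W V : Type) [AddCommGroup V] [Module F V] [FiniteDimensional F V]
    [AddCommGroup W] [Module F W] [FiniteDimensional F W] (h : finrank F W = finrank F V) :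
    Nat.card (W ≃ₗ[F] V) =
      injN (Fintype.card F) (finrank F V) (finrank F V) := by
  have := card_inj (F := F) W V
  rw [h] at this
  rw [← this]
  apply Nat.card_congr
  exact
    { toFun := fun e => ⟨e.toLinearMap, e.injective⟩
      invFun := fun f => LinearEquiv.ofBijective f.1
        ⟨f.2, (LinearMap.injective_iff_surjective_of_finrank_eq_finrank h).1 f.2⟩
      left_inv := fun e => by ext; rfl
      right_inv := fun f => by ext; rfl }

lemma card_lifts (U V W : Type) [AddCommGroup V] [Module F V] [FiniteDimensional F V]
    [AddCommGroup W] [Module F W] [FiniteDimensional F W]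
    [AddCommGroup U] [Module F U] [FiniteDimensional F U]
    (π : V →ₗ[F] W) (hπ : Function.Surjective π) (D : U →ₗ[F] W) :
    Nat.card {Z : U →ₗ[F] V // π ∘ₗ Z = D} =
      Fintype.card F ^ (finrank F U * finrank F (LinearMap.ker π)) := by
  rw [← card_hom]
  obtain ⟨s, hs⟩ := π.exists_rightInverse_of_surjective (LinearMap.range_eq_top.2 hπ)
  have hs' : ∀ x, π (s x) = x := fun x => by simpa using congrArg (fun f => f x) hs
  apply Nat.card_congr
  exact
    { toFun := fun Z => LinearMap.codRestrict _ (Z.1 - s ∘ₗ D) (fun c => by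
        have := congrArg (fun f => f c) Z.2
        simp at this
        simp [hs', this])
      invFun := fun Y => ⟨(LinearMap.ker π).subtype ∘ₗ Y + s ∘ₗ D, by
        ext x; simp [hs']⟩
      left_inv := fun Z => by ext; simp
      right_inv := fun Z => by ext; simp }

lemma card_compl (U W : Type)
    [AddCommGroup W] [Module F W] [FiniteDimensional F W]
    [AddCommGroup U] [Module F U] [FiniteDimensional F U]
    (A : W →ₗ[F] W) :
    Nat.card {C : U →ₗ[F] W // Function.Surjective (LinearMap.coprod A C)} =
      injN (Fintype.card F) (finrank F U) (finrank F W - finrank F (LinearMap.range A)) *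
      Fintype.card F ^ (finrank F U * finrank F (LinearMap.range A)) := by
  have hQ : finrank F (W ⧸ LinearMap.range A) = finrank F W - finrank F (LinearMap.range A) := by
    have := Submodule.finrank_quotient_add_finrank (LinearMap.range A)
    omega
  have key : ∀ C : U →ₗ[F] W, Function.Surjective (LinearMap.coprod A C) ↔
      Function.Surjective ((LinearMap.range A).mkQ ∘ₗ C) := by
    intro C
    constructor
    · intro h x
      obtain ⟨w, rfl⟩ := Submodule.mkQ_surjective _ x
      obtain ⟨⟨a, c⟩, rfl⟩ := h w
      refine ⟨c, ?_⟩
      simp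
    · intro h w
      obtain ⟨c, hc⟩ := h ((LinearMap.range A).mkQ w)
      simp only [LinearMap.comp_apply, Submodule.mkQ_apply] at hc
      have := (Submodule.Quotient.eq _).1 hc.symm
      obtain ⟨a, ha⟩ := this
      exact ⟨(a, c), by simp [ha]⟩
  have e : {C : U →ₗ[F] W // Function.Surjective (LinearMap.coprod A C)} ≃
      Σ D : {D : U →ₗ[F] (W ⧸ LinearMap.range A) // Function.Surjective D},
        {C : U →ₗ[F] W // (LinearMap.range A).mkQ ∘ₗ C = D.1} :=
    { toFun := fun C => ⟨⟨_, (key C.1).1 C.2⟩, ⟨C.1, rfl⟩⟩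
      invFun := fun x => ⟨x.2.1, (key _).2 (by rw [x.2.2]; exact x.1.2)⟩
      left_inv := fun C => rfl
      right_inv := by
        rintro ⟨⟨D, hD⟩, ⟨C, hC⟩⟩
        dsimp only at hC
        subst hC
        rfl }
  have : Finite (U →ₗ[F] (W ⧸ LinearMap.range A)) := finite_of_fd (F := F) _
  have := finite_of_fd (F := F) (U →ₗ[F] W)
  have := Fintype.ofFinite {D : U →ₗ[F] (W ⧸ LinearMap.range A) // Function.Surjective D}
  have hc : ∀ D : {D : U →ₗ[F] (W ⧸ LinearMap.range A) // Function.Surjective D},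
      Nat.card {C : U →ₗ[F] W // (LinearMap.range A).mkQ ∘ₗ C = D.1} =
        Fintype.card F ^ (finrank F U * finrank F (LinearMap.range A)) := by
    intro D
    rw [card_lifts U W _ (LinearMap.range A).mkQ (Submodule.mkQ_surjective _)]
    congr 2
    rw [Submodule.ker_mkQ]
  rw [Nat.card_congr e, Nat.card_sigma, Finset.sum_congr rfl (fun D _ => hc D)]
  rw [Finset.sum_const, smul_eq_mul, Finset.card_univ, ← Nat.card_eq_fintype_card, card_surj, hQ]

end part1
end

section
open Module

lemma card_fiber {α β : Type} [Finite α] [Finite β] (p : α → Prop) (r : α → β → Prop)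
    [Fintype {a // p a}] :
    Nat.card {x : α × β // p x.1 ∧ r x.1 x.2} = ∑ a : {a // p a}, Nat.card {b // r a.1 b} := by
  rw [← Nat.card_sigma]
  apply Nat.card_congr
  exact
    { toFun := fun x => ⟨⟨x.1.1, x.2.1⟩, ⟨x.1.2, x.2.2⟩⟩
      invFun := fun y => ⟨(y.1.1, y.2.1), y.1.2, y.2.2⟩
      left_inv := fun x => rfl
      right_inv := fun y => rfl }

/-- Number of commuting pairs with first member of corank `k`. -/
noncomputable def Pnk (F : Type) [Field F] (n k : ℕ) : ℕ :=
  Nat.card {P : Module.End F (Fin n → F) × Module.End F (Fin n → F) //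
    P.1 * P.2 = P.2 * P.1 ∧ finrank F (LinearMap.range P.1) + k = n}

section part1
variable {F : Type} [Field F] [Fintype F]

lemma card_std (U W : Type)
    [AddCommGroup W] [Module F W] [FiniteDimensional F W]
    [AddCommGroup U] [Module F U] [FiniteDimensional F U]
    [Fintype {P : Module.End F W × Module.End F W // P.1 * P.2 = P.2 * P.1}] :
    Nat.card {P : Module.End F (W × U) × Module.End F (W × U) //
      P.1 * P.2 = P.2 * P.1 ∧ LinearMap.range P.1 = LinearMap.range (LinearMap.inl F W U)} =
    ∑ P : {P : Module.End F W × Module.End F W // P.1 * P.2 = P.2 * P.1},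
      (injN (Fintype.card F) (finrank F U) (finrank F W - finrank F (LinearMap.range P.1.1)) *
      Fintype.card F ^ (finrank F U * finrank F (LinearMap.range P.1.1))) *
        Fintype.card F ^ (finrank F U * finrank F U) := by
  have e : {P : Module.End F (W × U) × Module.End F (W × U) //
      P.1 * P.2 = P.2 * P.1 ∧ LinearMap.range P.1 = LinearMap.range (LinearMap.inl F W U)} ≃
      {x : (Module.End F W × Module.End F W) × ((U →ₗ[F] W) × (U →ₗ[F] W × U)) //
        (x.1.1 * x.1.2 = x.1.2 * x.1.1) ∧ (Function.Surjective (LinearMap.coprod x.1.1 x.2.1) ∧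
          LinearMap.coprod x.1.1 x.2.1 ∘ₗ x.2.2 = x.1.2 ∘ₗ x.2.1)} := by
    have hz : ∀ A : Module.End F (W × U), LinearMap.range A = LinearMap.range (LinearMap.inl F W U) →
        ∀ x, (A x).2 = 0 := by
      intro A h x
      have : A x ∈ LinearMap.range (LinearMap.inl F W U) := h ▸ LinearMap.mem_range_self A x
      obtain ⟨w, hw⟩ := this
      rw [← hw]; rfl
    have hB : ∀ A B : Module.End F (W × U), A * B = B * A →
        LinearMap.range A = LinearMap.range (LinearMap.inl F W U) → ∀ w, (B (w, 0)).2 = 0 := by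
      intro A B hc h w
      have : ((w, 0) : W × U) ∈ LinearMap.range A := by rw [h]; exact ⟨w, rfl⟩
      obtain ⟨y, hy⟩ := this
      rw [← hy]
      have : B (A y) = A (B y) := by
        have := congrArg (fun f => f y) hc
        exact this.symm
      rw [this]
      exact hz A h _
    have hsplit : ∀ (A : Module.End F (W × U)) (w : W) (u : U), A (w, u) = A (w, 0) + A (0, u) := by
      intro A w u
      rw [← map_add]; simp
    refine
    { toFun := fun P => ⟨((LinearMap.fst F W U ∘ₗ P.1.1 ∘ₗ LinearMap.inl F W U,
          LinearMap.fst F W U ∘ₗ P.1.2 ∘ₗ LinearMap.inl F W U),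
          (LinearMap.fst F W U ∘ₗ P.1.1 ∘ₗ LinearMap.inr F W U, P.1.2 ∘ₗ LinearMap.inr F W U)), ?_⟩
      invFun := fun x => ⟨(LinearMap.inl F W U ∘ₗ LinearMap.coprod x.1.1.1 x.1.2.1,
          LinearMap.coprod (LinearMap.inl F W U ∘ₗ x.1.1.2) x.1.2.2), ?_⟩
      left_inv := ?_
      right_inv := ?_ }
    · obtain ⟨⟨A, B⟩, hc, hr⟩ := P
      dsimp only at hc hr ⊢
      have hA := hz A hr
      have hB := hB A B hc hr
      have hc' : ∀ y, A (B y) = B (A y) := fun y => congrArg (fun f => f y) hc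
      have fA : ∀ x, A x = ((A x).1, 0) := fun x => Prod.ext rfl (hA x)
      have fB : ∀ w, B (w, 0) = ((B (w, 0)).1, 0) := fun x => Prod.ext rfl (hB x)
      have hcop : ∀ y : W × U, (A (y.1, 0)).1 + (A (0, y.2)).1 = (A y).1 := by
        intro y
        rw [← Prod.fst_add, ← hsplit]
      refine ⟨?_, ?_, ?_⟩
      · ext w
        simp only [Module.End.mul_apply, LinearMap.comp_apply, LinearMap.inl_apply, LinearMap.fst_apply]
        rw [← fB, hc', ← fA]
      · intro w
        have : ((w, 0) : W × U) ∈ LinearMap.range A := by rw [hr]; exact ⟨w, rfl⟩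
        obtain ⟨y, hy⟩ := this
        refine ⟨y, ?_⟩
        simp only [LinearMap.coprod_apply, LinearMap.comp_apply, LinearMap.inl_apply,
          LinearMap.inr_apply, LinearMap.fst_apply]
        rw [hcop, hy]
      · ext u
        simp only [LinearMap.coprod_apply, LinearMap.comp_apply, LinearMap.inl_apply,
          LinearMap.inr_apply, LinearMap.fst_apply]
        rw [hcop, hc', ← fA]
    · obtain ⟨⟨⟨A, B⟩, ⟨C, Z⟩⟩, hc, hs, hZ⟩ := x
      dsimp only at hc hs hZ ⊢
      constructor
      · have h1 : ∀ w, A (B w) = B (A w) := fun w => congrArg (fun f => f w) hc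
        have h2 : ∀ u, A (Z u).1 + C (Z u).2 = B (C u) := fun u => by
          simpa using congrArg (fun f => f u) hZ
        ext x <;> simp [h1, h2]
      · rw [LinearMap.range_comp, LinearMap.range_eq_top.2 hs, Submodule.map_top]
    · rintro ⟨⟨A, B⟩, hc, hr⟩
      dsimp only at hc hr
      have hA := hz A hr
      have hB := hB A B hc hr
      apply Subtype.ext
      dsimp only
      refine Prod.ext ?_ ?_
      · have h00 : (A (0, 0)).1 = 0 := by rw [Prod.mk_zero_zero, map_zero]; rfl
        ext x <;> simp [hA, h00]
      · ext x <;> simp [hB]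
    · rintro ⟨⟨⟨A, B⟩, ⟨C, Z⟩⟩, hc, hs, hZ⟩
      apply Subtype.ext
      dsimp only
      refine Prod.ext (Prod.ext ?_ ?_) (Prod.ext ?_ ?_) <;> ext x <;> simp
  have i1 := finite_of_fd (F := F) (Module.End F W)
  have i2 := finite_of_fd (F := F) (U →ₗ[F] W)
  have i3 := finite_of_fd (F := F) (U →ₗ[F] W × U)
  rw [Nat.card_congr e, card_fiber (fun a : Module.End F W × Module.End F W => a.1 * a.2 = a.2 * a.1)
    (fun a (b : (U →ₗ[F] W) × (U →ₗ[F] W × U)) => Function.Surjective (LinearMap.coprod a.1 b.1) ∧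
          LinearMap.coprod a.1 b.1 ∘ₗ b.2 = a.2 ∘ₗ b.1)]
  apply Finset.sum_congr rfl
  rintro ⟨⟨A, B⟩, hc⟩ -
  dsimp only
  have := Fintype.ofFinite {C : U →ₗ[F] W // Function.Surjective (LinearMap.coprod A C)}
  rw [card_fiber (fun C : U →ₗ[F] W => Function.Surjective (LinearMap.coprod A C))
    (fun C (Z : U →ₗ[F] W × U) => LinearMap.coprod A C ∘ₗ Z = B ∘ₗ C), ← card_compl]
  rw [Finset.sum_congr rfl (g := fun _ => Fintype.card F ^ (finrank F U * finrank F U))]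
  · rw [Finset.sum_const, smul_eq_mul, Finset.card_univ, ← Nat.card_eq_fintype_card]
  · rintro ⟨C, hC⟩ -
    rw [card_lifts _ _ _ _ hC]
    congr 2
    have h1 := (LinearMap.coprod A C).finrank_range_add_finrank_ker
    rw [LinearMap.range_eq_top.2 hC, finrank_top, finrank_prod] at h1
    omega

lemma card_fixed (U W V : Type)
    [AddCommGroup W] [Module F W] [FiniteDimensional F W]
    [AddCommGroup U] [Module F U] [FiniteDimensional F U]
    [AddCommGroup V] [Module F V] [FiniteDimensional F V]
    (hV : finrank F V = finrank F W + finrank F U) (ι : W →ₗ[F] V) (hι : Function.Injective ι) :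
    Nat.card {P : Module.End F V × Module.End F V //
      P.1 * P.2 = P.2 * P.1 ∧ LinearMap.range P.1 = LinearMap.range ι} =
    Nat.card {P : Module.End F (W × U) × Module.End F (W × U) //
      P.1 * P.2 = P.2 * P.1 ∧ LinearMap.range P.1 = LinearMap.range (LinearMap.inl F W U)} := by
  obtain ⟨e, he⟩ : ∃ e : (W × U) ≃ₗ[F] V, e.toLinearMap ∘ₗ LinearMap.inl F W U = ι := by
    obtain ⟨Q, hQ⟩ := Submodule.exists_isCompl (LinearMap.range ι)
    have h1 := Submodule.finrank_add_eq_of_isCompl hQ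
    rw [LinearMap.finrank_range_of_inj hι] at h1
    let f : U ≃ₗ[F] Q := LinearEquiv.ofFinrankEq _ _ (by omega)
    refine ⟨((LinearEquiv.ofInjective ι hι).prodCongr f).trans (Submodule.prodEquivOfIsCompl _ _ hQ), ?_⟩
    ext w
    simp
  symm
  apply Nat.card_congr
  refine Equiv.subtypeEquiv (Equiv.prodCongr e.conj.toEquiv e.conj.toEquiv) ?_
  rintro ⟨A, B⟩
  simp only [Equiv.prodCongr_apply, Prod.map_apply, LinearEquiv.coe_toEquiv]
  refine and_congr ?_ ?_
  · rw [Module.End.mul_eq_comp, Module.End.mul_eq_comp, Module.End.mul_eq_comp,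
      Module.End.mul_eq_comp, ← LinearEquiv.conj_comp, ← LinearEquiv.conj_comp]
    exact e.conj.injective.eq_iff.symm
  · have : LinearMap.range (e.conj A) = (LinearMap.range A).map e.toLinearMap := by
      rw [LinearEquiv.conj_apply, LinearMap.range_comp, LinearEquiv.range, Submodule.map_top,
        LinearMap.range_comp]
    rw [this, ← he, LinearMap.range_comp]
    exact (Submodule.map_injective_of_injective e.injective).eq_iff.symm

theorem Pnk_rec (m k : ℕ) :
    injN (Fintype.card F) m m * Pnk F (m + k) k =
      injN (Fintype.card F) (m + k) m * ∑ j ∈ Finset.range (m + 1),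
        Pnk F m j * ((injN (Fintype.card F) k j * Fintype.card F ^ (k * (m - j))) *
          Fintype.card F ^ (k * k)) := by
  classical
  let W := Fin m → F
  let V := Fin (m + k) → F
  let U := Fin k → F
  have hW : finrank F W = m := by simp [W]
  have hV : finrank F V = m + k := by simp [V]
  have hU : finrank F U = k := by simp [U]
  have i1 := finite_of_fd (F := F) (Module.End F W)
  have i1 := finite_of_fd (F := F) (Module.End F V)
  have i1 := finite_of_fd (F := F) (W →ₗ[F] V)
  have := Fintype.ofFinite {P : Module.End F W × Module.End F W // P.1 * P.2 = P.2 * P.1}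
  -- double count
  have h1 : Nat.card {x : (W →ₗ[F] V) × (Module.End F V × Module.End F V) //
      Function.Injective x.1 ∧ (x.2.1 * x.2.2 = x.2.2 * x.2.1 ∧
        LinearMap.range x.2.1 = LinearMap.range x.1)} =
      injN (Fintype.card F) m m * Pnk F (m + k) k := by
    have : Nat.card {x : (W →ₗ[F] V) × (Module.End F V × Module.End F V) //
      Function.Injective x.1 ∧ (x.2.1 * x.2.2 = x.2.2 * x.2.1 ∧
        LinearMap.range x.2.1 = LinearMap.range x.1)} =
       Nat.card {x : (Module.End F V × Module.End F V) × (W →ₗ[F] V) //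
      (x.1.1 * x.1.2 = x.1.2 * x.1.1 ∧ finrank F (LinearMap.range x.1.1) + k = m + k) ∧
        (Function.Injective x.2 ∧ LinearMap.range x.1.1 = LinearMap.range x.2)} := by
      apply Nat.card_congr
      refine Equiv.subtypeEquiv (Equiv.prodComm _ _) ?_
      rintro ⟨ι, A, B⟩
      simp only [Equiv.prodComm_apply, Prod.swap_prod_mk]
      constructor
      · rintro ⟨h1, h2, h3⟩
        have h4 : finrank F (LinearMap.range A) = m := by
          rw [h3, LinearMap.finrank_range_of_inj h1, hW]
        exact ⟨⟨h2, congrArg (· + k) h4⟩, h1, h3⟩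
      · rintro ⟨⟨h1, h2⟩, h3, h4⟩
        exact ⟨h3, h1, h4⟩
    rw [this]
    have := Fintype.ofFinite {P : Module.End F V × Module.End F V //
      P.1 * P.2 = P.2 * P.1 ∧ finrank F (LinearMap.range P.1) + k = m + k}
    rw [card_fiber (fun x : Module.End F V × Module.End F V =>
      x.1 * x.2 = x.2 * x.1 ∧ finrank F (LinearMap.range x.1) + k = m + k)
      (fun x (ι : W →ₗ[F] V) => Function.Injective ι ∧ LinearMap.range x.1 = LinearMap.range ι)]
    rw [Finset.sum_congr rfl (g := fun _ => injN (Fintype.card F) m m)]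
    · rw [Finset.sum_const, smul_eq_mul, Finset.card_univ, ← Nat.card_eq_fintype_card, mul_comm]
      rfl
    · rintro ⟨⟨A, B⟩, hc, hr⟩ -
      dsimp only at hc hr ⊢
      have hr' : finrank F (LinearMap.range A) = m := by omega
      have := card_equivs (F := F) W (LinearMap.range A) (by rw [hW, hr'])
      rw [hr'] at this
      rw [← this]
      symm
      apply Nat.card_congr
      refine Equiv.ofBijective (fun e => ⟨(LinearMap.range A).subtype ∘ₗ e.toLinearMap, ?_, ?_⟩) ⟨?_, ?_⟩
      · exact (Submodule.injective_subtype _).comp e.injective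
      · rw [LinearMap.range_comp, LinearEquiv.range, Submodule.map_top, Submodule.range_subtype]
      · intro e f h
        apply LinearEquiv.ext
        intro w
        have := congrArg (fun z => z.1 w) h
        simpa using this
      · rintro ⟨ι, hi, hr⟩
        refine ⟨(LinearEquiv.ofInjective ι hi).trans (LinearEquiv.ofEq _ _ hr.symm), ?_⟩
        ext w
        simp
  rw [← h1]
  have := Fintype.ofFinite {ι : W →ₗ[F] V // Function.Injective ι}
  rw [card_fiber (fun ι : W →ₗ[F] V => Function.Injective ι)
    (fun ι (x : Module.End F V × Module.End F V) => x.1 * x.2 = x.2 * x.1 ∧ LinearMap.range x.1 = LinearMap.range ι)]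
  rw [Finset.sum_congr rfl (fun ι _ => (card_fixed U W V (by rw [hV, hW, hU]) ι.1 ι.2).trans
    (card_std U W))]
  rw [Finset.sum_const, smul_eq_mul, Finset.card_univ, ← Nat.card_eq_fintype_card, card_inj, hV, hW, hU]
  congr 1
  have hle : ∀ A : Module.End F W, finrank F (LinearMap.range A) ≤ m := fun A => by
    have := Submodule.finrank_le (LinearMap.range A)
    rwa [hW] at this
  rw [← Finset.sum_fiberwise_of_maps_to (s := Finset.univ) (t := Finset.range (m + 1))
    (g := fun P : {P : Module.End F W × Module.End F W // P.1 * P.2 = P.2 * P.1} =>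
      m - finrank F (LinearMap.range P.1.1))]
  · apply Finset.sum_congr rfl
    intro j hj
    have hj' : j ≤ m := by simpa [Nat.lt_succ_iff] using hj
    rw [Finset.sum_congr rfl (g := fun _ => ((injN (Fintype.card F) k j * Fintype.card F ^ (k * (m - j))) *
          Fintype.card F ^ (k * k)))]
    · rw [Finset.sum_const, smul_eq_mul]
      congr 1
      rw [← Fintype.card_subtype, ← Nat.card_eq_fintype_card, Pnk]
      apply Nat.card_congr
      refine (Equiv.subtypeSubtypeEquivSubtypeInter (fun P : Module.End F W × Module.End F W => P.1 * P.2 = P.2 * P.1) (fun P => m - finrank F (LinearMap.range P.1) = j)).trans ?_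
      refine Equiv.subtypeEquivRight ?_
      rintro ⟨A, B⟩
      have := hle A
      refine and_congr Iff.rfl ?_
      dsimp only at this ⊢
      constructor
      · intro h
        change finrank F (LinearMap.range A) + j = m
        omega
      · intro h
        change finrank F (LinearMap.range A) + j = m at h
        omega
    · intro P hP
      simp only [Finset.mem_filter, Finset.mem_univ, true_and] at hP
      have := hle P.1.1
      rw [hP, show finrank F (LinearMap.range P.1.1) = m - j by omega]
  · intro P _
    simp

end part1
end

section
open Module

lemma glOrder_pos {q : ℕ} (hq : 2 ≤ q) (n : ℕ) : 0 < glOrder q n := by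
  apply Finset.prod_pos
  intro i hi
  have h1 : (1 : ℝ) < q := by exact_mod_cast hq
  have := pow_lt_pow_right₀ h1 (Finset.mem_range.1 hi)
  linarith

lemma injN_cast {q : ℕ} (hq : 2 ≤ q) {n k : ℕ} (h : k ≤ n) :
    (injN q n k : ℝ) = ∏ i ∈ Finset.range k, ((q : ℝ) ^ n - (q : ℝ) ^ i) := by
  rw [injN, Nat.cast_prod]
  apply Finset.prod_congr rfl
  intro i hi
  rw [Nat.cast_sub]
  · push_cast; rfl
  · exact Nat.pow_le_pow_right (by omega) (by have := Finset.mem_range.1 hi; omega)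

lemma injN_self {q : ℕ} (hq : 2 ≤ q) (n : ℕ) : (injN q n n : ℝ) = glOrder q n := by
  rw [injN_cast hq le_rfl, glOrder]

lemma injN_mul {q : ℕ} (hq : 2 ≤ q) (m k : ℕ) :
    (injN q (m + k) m : ℝ) * ((q : ℝ) ^ (m * k) * glOrder q k) = glOrder q (m + k) := by
  rw [injN_cast hq (by omega), glOrder, glOrder, Finset.prod_range_add]
  congr 1
  have : (q : ℝ) ^ (m * k) = ∏ i ∈ Finset.range k, (q : ℝ) ^ m := by
    rw [Finset.prod_const, Finset.card_range, pow_mul]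
  rw [this, ← Finset.prod_mul_distrib]
  apply Finset.prod_congr rfl
  intro i _
  ring

/-- the coefficients `1/(1/q;1/q)_j`. -/
noncomputable def aq (q j : ℕ) : ℝ := (q : ℝ) ^ (j * j) / glOrder q j

lemma injN_zero {q n k : ℕ} (h : n < k) : injN q n k = 0 := by
  rw [injN]
  apply Finset.prod_eq_zero (i := n) (by simpa using h)
  simp

section
variable (F : Type) [Field F] [Fintype F]

lemma Pnk_zero {n k : ℕ} (h : n < k) : Pnk F n k = 0 := by
  rw [Pnk]
  have : IsEmpty {P : Module.End F (Fin n → F) × Module.End F (Fin n → F) //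
    P.1 * P.2 = P.2 * P.1 ∧ finrank F (LinearMap.range P.1) + k = n} := ⟨fun P => by
      have := P.2.2; omega⟩
  exact Nat.card_of_isEmpty

lemma pnk_rec {q : ℕ} (hF : Fintype.card F = q) (hq : 2 ≤ q) (m k : ℕ) :
    (Pnk F (m + k) k : ℝ) / glOrder q (m + k) =
      ∑ x ∈ Finset.HasAntidiagonal.antidiagonal k, (Pnk F m x.1 : ℝ) / glOrder q m * aq q x.2 := by
  have h := congrArg (fun n : ℕ => (n : ℝ)) (Pnk_rec (F := F) m k)
  rw [hF] at h
  simp only [Nat.cast_mul, Nat.cast_sum, Nat.cast_pow, injN_self hq] at h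
  have hm := glOrder_pos hq m
  have hk := glOrder_pos hq k
  have hmk := glOrder_pos hq (m + k)
  have hq0 : (0 : ℝ) < q := by positivity
  have e := injN_mul hq m k
  have hi : (injN q (m + k) m : ℝ) = glOrder q (m + k) / ((q : ℝ) ^ (m * k) * glOrder q k) := by
    rw [eq_div_iff (by positivity), e]
  rw [hi] at h
  have h2 : (Pnk F (m + k) k : ℝ) / glOrder q (m + k) = ∑ j ∈ Finset.range (m + 1),
      (Pnk F m j : ℝ) / glOrder q m * (((injN q k j : ℝ) * q ^ (k * (m - j)) * q ^ (k * k)) /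
        (q ^ (m * k) * glOrder q k)) := by
    have h3 : (Pnk F (m + k) k : ℝ) = (glOrder q m * Pnk F (m + k) k) / glOrder q m := by
      field_simp
    rw [h3, h, Finset.mul_sum, Finset.sum_div, Finset.sum_div]
    apply Finset.sum_congr rfl
    intro j _
    field_simp
  rw [h2, Finset.Nat.sum_antidiagonal_eq_sum_range_succ_mk]
  have h4 : ∀ j ∈ Finset.range (m + 1) ∩ Finset.range (k + 1), (Pnk F m j : ℝ) / glOrder q m * (((injN q k j : ℝ) * q ^ (k * (m - j)) * q ^ (k * k)) /
        (q ^ (m * k) * glOrder q k)) = (Pnk F m j : ℝ) / glOrder q m * aq q (k - j) := by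
    intro j hj
    simp only [Finset.mem_inter, Finset.mem_range] at hj
    obtain ⟨l, rfl⟩ : ∃ l, k = j + l := ⟨k - j, by omega⟩
    obtain ⟨r, rfl⟩ : ∃ r, m = j + r := ⟨m - j, by omega⟩
    congr 1
    have e2 := injN_mul hq j l
    have hl := glOrder_pos hq l
    rw [aq, Nat.add_sub_cancel_left, Nat.add_sub_cancel_left, ← e2]
    have hinj : (injN q (j + l) j : ℝ) ≠ 0 := by
      intro h0
      rw [h0, zero_mul] at e2
      linarith
    field_simp
    ring
  rw [← Finset.sum_subset (Finset.inter_subset_left (s₂ := Finset.range (k + 1))),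
    ← Finset.sum_subset (Finset.inter_subset_right (s₁ := Finset.range (m + 1)) (s₂ := Finset.range (k + 1))),
    Finset.sum_congr rfl h4]
  · intro j h1 h2
    rw [Pnk_zero]
    · simp
    · simp at h1 h2; omega
  · intro j h1 h2
    rw [injN_zero]
    · simp
    · simp at h1 h2; omega

lemma sum_Pnk (n : ℕ) : ∑ k ∈ Finset.range (n + 1), Pnk F n k = commPairs F n := by
  classical
  have i1 := finite_of_fd (F := F) (Module.End F (Fin n → F))
  have := Fintype.ofFinite {P : Module.End F (Fin n → F) × Module.End F (Fin n → F) // P.1 * P.2 = P.2 * P.1}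
  have e : commPairs F n = Nat.card {P : Module.End F (Fin n → F) × Module.End F (Fin n → F) //
      P.1 * P.2 = P.2 * P.1} := by
    rw [commPairs]
    apply Nat.card_congr
    let f := (Matrix.toLinAlgEquiv' (R := F) (n := Fin n))
    refine Equiv.subtypeEquiv (Equiv.prodCongr f.toEquiv f.toEquiv) ?_
    rintro ⟨A, B⟩
    change A * B = B * A ↔ f A * f B = f B * f A
    rw [← map_mul, ← map_mul]
    exact f.injective.eq_iff.symm
  have hle : ∀ A : Module.End F (Fin n → F), finrank F (LinearMap.range A) ≤ n := fun A => by
    have := Submodule.finrank_le (LinearMap.range A)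
    simpa using this
  rw [e, Nat.card_eq_fintype_card, ← Finset.card_univ,
    Finset.card_eq_sum_card_fiberwise (t := Finset.range (n + 1))
    (f := fun P : {P : Module.End F (Fin n → F) × Module.End F (Fin n → F) // P.1 * P.2 = P.2 * P.1} =>
      n - finrank F (LinearMap.range P.1.1))]
  · apply Finset.sum_congr rfl
    intro j hj
    have hj' : j ≤ n := by simpa [Nat.lt_succ_iff] using hj
    symm
    rw [← Fintype.card_subtype, ← Nat.card_eq_fintype_card, Pnk]
    apply Nat.card_congr
    refine (Equiv.subtypeSubtypeEquivSubtypeInter (fun P : Module.End F (Fin n → F) × Module.End F (Fin n → F) => P.1 * P.2 = P.2 * P.1) (fun P => n - finrank F (LinearMap.range P.1) = j)).trans ?_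
    refine Equiv.subtypeEquivRight ?_
    rintro ⟨A, B⟩
    have := hle A
    refine and_congr Iff.rfl ?_
    dsimp only at this ⊢
    omega
  · intro P _
    simp
end
end

section
open Filter Topology Finset.HasAntidiagonal

section abs
variable (p : ℕ → ℕ → ℝ) (α : ℕ → ℝ)

/-- row polynomial -/
noncomputable def rowQ (n : ℕ) (t : ℝ) : ℝ := ∑ k ∈ Finset.range (n + 1), p n k * t ^ k

/-- series of alpha -/
noncomputable def serS (w : ℝ) : ℝ := ∑' j, α j * w ^ j

variable {p α}

lemma sum_antidiag_shift (f : ℕ → ℕ → ℝ) (n : ℕ) :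
    ∑ x ∈ antidiagonal n, f (x.1 + x.2) x.2 = ∑ k ∈ Finset.range (n + 1), f n k := by
  rw [← Finset.Nat.sum_antidiagonal_swap (n := n), Finset.Nat.sum_antidiagonal_eq_sum_range_succ_mk]
  apply Finset.sum_congr rfl
  intro k hk
  have : n - k + k = n := by have := Finset.mem_range.1 hk; omega
  simp [this]

lemma sum_range_le_rowQ (hp : ∀ n k, 0 ≤ p n k) (hz : ∀ n k, n < k → p n k = 0) (m M : ℕ) (t : ℝ)
    (ht : 0 ≤ t) : ∑ k ∈ Finset.range M, p m k * t ^ k ≤ rowQ p m t := by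
  rw [rowQ]
  calc ∑ k ∈ Finset.range M, p m k * t ^ k ≤ ∑ k ∈ Finset.range (M + (m + 1)), p m k * t ^ k := by
        apply Finset.sum_le_sum_of_subset_of_nonneg
        · intro x; simp; omega
        · intro i _ _; have := hp m i; positivity
    _ = _ := by
        symm
        apply Finset.sum_subset
        · intro x; simp; omega
        · intro i _ h
          rw [hz m i (by simpa using h)]; simp

lemma hasSum_rowQ (hz : ∀ n k, n < k → p n k = 0) (m : ℕ) (t : ℝ) :
    HasSum (fun k => p m k * t ^ k) (rowQ p m t) := by
  apply hasSum_sum_of_ne_finset_zero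
  intro k hk
  rw [hz m k (by simpa using hk)]; simp

lemma term_rec (hrec : ∀ m k, p (m + k) k = ∑ x ∈ antidiagonal k, p m x.1 * α x.2)
    (u t : ℝ) (m k : ℕ) :
    p (m + k) k * u ^ (m + k) * t ^ k =
      u ^ m * ∑ x ∈ antidiagonal k, (p m x.1 * (u * t) ^ x.1) * (α x.2 * (u * t) ^ x.2) := by
  rw [hrec, Finset.sum_mul, Finset.sum_mul, Finset.mul_sum]
  apply Finset.sum_congr rfl
  intro x hx
  have : k = x.1 + x.2 := (mem_antidiagonal.1 hx).symm
  rw [this]; ring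

lemma step_le (hp : ∀ n k, 0 ≤ p n k) (hα : ∀ j, 0 ≤ α j) (hz : ∀ n k, n < k → p n k = 0)
    (hrec : ∀ m k, p (m + k) k = ∑ x ∈ antidiagonal k, p m x.1 * α x.2)
    (v t : ℝ) (hv : 0 ≤ v) (ht : 0 ≤ t) (ht1 : t ≤ 1) (hs : Summable fun j => α j * v ^ j) (M : ℕ) :
    ∑ n ∈ Finset.range M, v ^ n * rowQ p n t ≤
      (∑ n ∈ Finset.range M, v ^ n * rowQ p n (v * t)) * serS α (v * t) := by
  have hs' : Summable fun j => α j * (v * t) ^ j := by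
    refine Summable.of_nonneg_of_le (fun j => ?_) (fun j => ?_) hs
    · have := hα j; positivity
    · apply mul_le_mul_of_nonneg_left _ (hα j)
      exact pow_le_pow_left₀ (by positivity) (mul_le_of_le_one_right hv ht1) j
  have h1 : ∀ n, v ^ n * rowQ p n t =
      ∑ x ∈ antidiagonal n, p (x.1 + x.2) x.2 * v ^ (x.1 + x.2) * t ^ x.2 := by
    intro n
    rw [sum_antidiag_shift (fun a b => p a b * v ^ a * t ^ b), rowQ, Finset.mul_sum]
    apply Finset.sum_congr rfl
    intro k _; ring
  have hnn : ∀ a b, 0 ≤ p a b * v ^ a * t ^ b := fun a b => by have := hp a b; positivity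
  calc ∑ n ∈ Finset.range M, v ^ n * rowQ p n t
      = ∑ n ∈ Finset.range M, ∑ x ∈ antidiagonal n, p (x.1 + x.2) x.2 * v ^ (x.1 + x.2) * t ^ x.2 :=
        Finset.sum_congr rfl fun n _ => h1 n
    _ ≤ ∑ x ∈ Finset.range M ×ˢ Finset.range M, p (x.1 + x.2) x.2 * v ^ (x.1 + x.2) * t ^ x.2 := by
        rw [Finset.sum_sigma']
        rw [← Finset.sum_image (s := (Finset.range M).sigma fun n => antidiagonal n)
          (g := fun y => y.2) (f := fun x : ℕ × ℕ => p (x.1 + x.2) x.2 * v ^ (x.1 + x.2) * t ^ x.2)]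
        · apply Finset.sum_le_sum_of_subset_of_nonneg
          · intro x hx
            simp only [Finset.mem_image, Finset.mem_sigma, Finset.mem_range, mem_antidiagonal] at hx
            obtain ⟨⟨n, y⟩, ⟨h1, h2⟩, rfl⟩ := hx
            simp only [Finset.mem_product, Finset.mem_range]
            dsimp only at *
            omega
          · intro x _ _; exact hnn _ _
        · rintro ⟨n, y⟩ h1 ⟨n', y'⟩ h2 h
          simp at h1 h2 h
          obtain ⟨_, rfl⟩ := h1
          obtain ⟨_, rfl⟩ := h2
          subst h
          rfl
    _ = ∑ m ∈ Finset.range M, v ^ m * ∑ k ∈ Finset.range M,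
          ∑ x ∈ antidiagonal k, (p m x.1 * (v * t) ^ x.1) * (α x.2 * (v * t) ^ x.2) := by
        rw [Finset.sum_product]
        apply Finset.sum_congr rfl
        intro m _
        rw [Finset.mul_sum]
        apply Finset.sum_congr rfl
        intro k _
        exact term_rec hrec v t m k
    _ ≤ ∑ m ∈ Finset.range M, v ^ m * (rowQ p m (v * t) * serS α (v * t)) := by
        apply Finset.sum_le_sum
        intro m _
        apply mul_le_mul_of_nonneg_left _ (by positivity)
        calc _ ≤ ∑ x ∈ Finset.range M ×ˢ Finset.range M, (p m x.1 * (v * t) ^ x.1) * (α x.2 * (v * t) ^ x.2) := by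
              rw [Finset.sum_sigma']
              rw [← Finset.sum_image (s := (Finset.range M).sigma fun n => antidiagonal n)
                (g := fun y => y.2) (f := fun x : ℕ × ℕ => (p m x.1 * (v * t) ^ x.1) * (α x.2 * (v * t) ^ x.2))]
              · apply Finset.sum_le_sum_of_subset_of_nonneg
                · intro x hx
                  simp only [Finset.mem_image, Finset.mem_sigma, Finset.mem_range, mem_antidiagonal] at hx
                  obtain ⟨⟨n, y⟩, ⟨h1, h2⟩, rfl⟩ := hx
                  simp only [Finset.mem_product, Finset.mem_range]
                  dsimp only at *
                  omega
                · intro x _ _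
                  have := hp m x.1
                  have := hα x.2
                  positivity
              · rintro ⟨n, y⟩ h1 ⟨n', y'⟩ h2 h
                simp at h1 h2 h
                obtain ⟨_, rfl⟩ := h1
                obtain ⟨_, rfl⟩ := h2
                subst h
                rfl
          _ = (∑ k ∈ Finset.range M, p m k * (v * t) ^ k) * ∑ j ∈ Finset.range M, α j * (v * t) ^ j := by
              rw [Finset.sum_mul_sum, Finset.sum_product]
          _ ≤ _ := by
              apply mul_le_mul
              · exact sum_range_le_rowQ hp hz _ _ _ (by positivity)
              · apply hs'.sum_le_tsum
                intro j _; have := hα j; positivity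
              · apply Finset.sum_nonneg; intro j _; have := hα j; positivity
              · apply Finset.sum_nonneg; intro j _; have := hp m j; positivity
    _ = _ := by
        rw [Finset.sum_mul]
        apply Finset.sum_congr rfl
        intro m _; ring

lemma rowQ_zero (n : ℕ) : rowQ p n 0 = p n 0 := by
  rw [rowQ, Finset.sum_range_succ']
  simp

lemma summable_rows (hp : ∀ n k, 0 ≤ p n k) (hα : ∀ j, 0 ≤ α j) (hz : ∀ n k, n < k → p n k = 0)
    (hrec : ∀ m k, p (m + k) k = ∑ x ∈ antidiagonal k, p m x.1 * α x.2)
    (v : ℝ) (hv : 0 ≤ v) (hv1 : v < 1) (hs : Summable fun j => α j * v ^ j)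
    (h0 : Summable fun n => p n 0 * v ^ n) (Bd : ℝ)
    (hB : ∀ N, ∏ i ∈ Finset.range N, serS α (v ^ (i + 1)) ≤ Bd) :
    Summable fun n => v ^ n * rowQ p n 1 := by
  have hS : ∀ w, 0 ≤ w → 0 ≤ serS α w := fun w hw => tsum_nonneg fun j => by
    have := hα j; positivity
  have hQ : ∀ n t, 0 ≤ t → 0 ≤ rowQ p n t := fun n t ht => Finset.sum_nonneg fun k _ => by
    have := hp n k; positivity
  apply summable_of_sum_range_le (c := (∑' n, p n 0 * v ^ n) * Bd)
  · intro n; have := hQ n 1 zero_le_one; positivity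
  intro M
  have hiter : ∀ N, ∑ n ∈ Finset.range M, v ^ n * rowQ p n 1 ≤
      (∑ n ∈ Finset.range M, v ^ n * rowQ p n (v ^ N)) * ∏ i ∈ Finset.range N, serS α (v ^ (i + 1)) := by
    intro N
    induction N with
    | zero => simp
    | succ N ih =>
      refine ih.trans ?_
      have := step_le hp hα hz hrec v (v ^ N) hv (by positivity) (pow_le_one₀ hv hv1.le) hs M
      rw [← pow_succ'] at this
      rw [Finset.prod_range_succ, mul_comm (∏ i ∈ Finset.range N, serS α (v ^ (i + 1))), ← mul_assoc]
      apply mul_le_mul_of_nonneg_right this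
      exact Finset.prod_nonneg fun i _ => hS _ (by positivity)
  have hiter2 : ∀ N, ∑ n ∈ Finset.range M, v ^ n * rowQ p n 1 ≤
      (∑ n ∈ Finset.range M, v ^ n * rowQ p n (v ^ N)) * Bd := by
    intro N
    refine (hiter N).trans (mul_le_mul_of_nonneg_left (hB N) ?_)
    exact Finset.sum_nonneg fun n _ => mul_nonneg (by positivity) (hQ n _ (by positivity))
  have hlim : Tendsto (fun N => (∑ n ∈ Finset.range M, v ^ n * rowQ p n (v ^ N)) * Bd) atTop
      (𝓝 ((∑ n ∈ Finset.range M, v ^ n * rowQ p n 0) * Bd)) := by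
    have hc : Continuous fun t => (∑ n ∈ Finset.range M, v ^ n * rowQ p n t) * Bd := by
      unfold rowQ; fun_prop
    exact (hc.tendsto 0).comp (tendsto_pow_atTop_nhds_zero_of_lt_one hv hv1)
  refine (ge_of_tendsto' hlim hiter2).trans ?_
  apply mul_le_mul_of_nonneg_right
  · simp_rw [rowQ_zero]
    calc _ = ∑ n ∈ Finset.range M, p n 0 * v ^ n := Finset.sum_congr rfl fun n _ => mul_comm _ _
      _ ≤ _ := h0.sum_le_tsum _ fun n _ => by have := hp n 0; positivity
  · have := hB 0; simp at this; linarith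

lemma func_eq (hp : ∀ n k, 0 ≤ p n k) (hα : ∀ j, 0 ≤ α j) (hz : ∀ n k, n < k → p n k = 0)
    (hrec : ∀ m k, p (m + k) k = ∑ x ∈ antidiagonal k, p m x.1 * α x.2)
    (u t : ℝ) (ht : |t| ≤ 1) (hs : Summable fun j => α j * |u| ^ j)
    (hr : Summable fun n => |u| ^ n * rowQ p n 1) :
    ∑' n, u ^ n * rowQ p n t = (∑' n, u ^ n * rowQ p n (u * t)) * serS α (u * t) := by
  have hs' : Summable fun j => ‖α j * (u * t) ^ j‖ := by
    refine Summable.of_nonneg_of_le (fun j => norm_nonneg _) (fun j => ?_) hs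
    rw [norm_mul, norm_pow, Real.norm_eq_abs, Real.norm_eq_abs, abs_of_nonneg (hα j), abs_mul]
    apply mul_le_mul_of_nonneg_left _ (hα j)
    exact pow_le_pow_left₀ (by positivity) (mul_le_of_le_one_right (abs_nonneg _) ht) j
  let g : ℕ × ℕ → ℝ := fun x => p (x.1 + x.2) x.2 * u ^ (x.1 + x.2) * t ^ x.2
  have hG : Summable fun x : ℕ × ℕ => p (x.1 + x.2) x.2 * |u| ^ (x.1 + x.2) := by
    rw [← Finset.HasAntidiagonal.sigmaAntidiagonalEquivProd.summable_iff, summable_sigma_of_nonneg]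
    · constructor
      · intro n; exact (hasSum_fintype _).summable
      · refine hr.congr fun n => ?_
        simp only [tsum_fintype, Function.comp_apply, sigmaAntidiagonalEquivProd_apply]
        rw [Finset.sum_coe_sort (antidiagonal n) (fun x : ℕ × ℕ => p (x.1 + x.2) x.2 * |u| ^ (x.1 + x.2)),
          sum_antidiag_shift (fun a b => p a b * |u| ^ a), rowQ, Finset.mul_sum]
        apply Finset.sum_congr rfl
        intro k _; ring
    · intro x
      have := hp
      simp only [Function.comp_apply]
      exact mul_nonneg (hp _ _) (by positivity)
  have hg : Summable g := by
    refine Summable.of_norm_bounded hG fun x => ?_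
    simp only [g, norm_mul, norm_pow, Real.norm_eq_abs]
    rw [abs_of_nonneg (hp _ _)]
    apply mul_le_of_le_one_right
    · exact mul_nonneg (hp _ _) (by positivity)
    · exact pow_le_one₀ (abs_nonneg _) ht
  have h1 : HasSum (fun n => u ^ n * rowQ p n t) (∑' x, g x) := by
    have := (Finset.HasAntidiagonal.sigmaAntidiagonalEquivProd.hasSum_iff.2 hg.hasSum).sigma
      (fun n => hasSum_fintype _)
    refine this.congr_fun ?_
    intro n
    simp only [Function.comp_apply, sigmaAntidiagonalEquivProd_apply]
    rw [Finset.sum_coe_sort (antidiagonal n) g,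
      sum_antidiag_shift (fun a b => p a b * u ^ a * t ^ b), rowQ, Finset.mul_sum]
    apply Finset.sum_congr rfl
    intro k _; ring
  have h2 : HasSum (fun m => u ^ m * (rowQ p m (u * t) * serS α (u * t))) (∑' x, g x) := by
    refine hg.hasSum.prod_fiberwise fun m => ?_
    have hq := hasSum_rowQ hz m (u * t)
    have hqs : Summable fun k => ‖p m k * (u * t) ^ k‖ := by
      apply summable_of_ne_finset_zero (s := Finset.range (m + 1))
      intro k hk
      rw [hz m k (by simpa using hk)]; simp
    have e := tsum_mul_tsum_eq_tsum_sum_antidiagonal_of_summable_norm hqs hs'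
    have e2 := summable_norm_sum_mul_antidiagonal_of_summable_norm hqs hs'
    rw [hq.tsum_eq] at e
    rw [serS, e]
    refine (e2.of_norm.hasSum.mul_left (u ^ m)).congr_fun fun k => ?_
    exact term_rec hrec u t m k
  rw [h1.tsum_eq, ← h2.tsum_eq, ← tsum_mul_right]
  apply tsum_congr
  intro m; ring

theorem abs_main (hp : ∀ n k, 0 ≤ p n k) (hα : ∀ j, 0 ≤ α j) (hz : ∀ n k, n < k → p n k = 0)
    (hrec : ∀ m k, p (m + k) k = ∑ x ∈ antidiagonal k, p m x.1 * α x.2)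
    (u : ℝ) (hu : |u| < 1) (hs : Summable fun j => α j * |u| ^ j)
    (h0 : Summable fun n => p n 0 * |u| ^ n) (Bd : ℝ)
    (hB : ∀ N, ∏ i ∈ Finset.range N, serS α (|u| ^ (i + 1)) ≤ Bd) :
    Summable (fun n => rowQ p n 1 * |u| ^ n) ∧
    Tendsto (fun N => (∑' n, p n 0 * u ^ n) * ∏ i ∈ Finset.range N, serS α (u ^ (i + 1))) atTop
      (𝓝 (∑' n, rowQ p n 1 * u ^ n)) := by
  have hr := summable_rows hp hα hz hrec |u| (abs_nonneg u) hu hs h0 Bd hB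
  refine ⟨hr.congr fun n => mul_comm _ _, ?_⟩
  have hiter : ∀ N, ∑' n, u ^ n * rowQ p n 1 =
      (∑' n, u ^ n * rowQ p n (u ^ N)) * ∏ i ∈ Finset.range N, serS α (u ^ (i + 1)) := by
    intro N
    induction N with
    | zero => simp
    | succ N ih =>
      rw [ih, func_eq hp hα hz hrec u (u ^ N) ?_ hs hr, ← pow_succ', Finset.prod_range_succ]
      · ring
      · rw [abs_pow]; exact pow_le_one₀ (abs_nonneg _) hu.le
  have hlim : Tendsto (fun N => ∑' n, u ^ n * rowQ p n (u ^ N)) atTop (𝓝 (∑' n, u ^ n * rowQ p n 0)) := by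
    apply tendsto_tsum_of_dominated_convergence hr
    · intro n
      have hc : Continuous fun t => u ^ n * rowQ p n t := by
        unfold rowQ; fun_prop
      exact (hc.tendsto 0).comp (tendsto_pow_atTop_nhds_zero_of_abs_lt_one hu)
    · refine Eventually.of_forall fun N n => ?_
      rw [norm_mul, norm_pow, Real.norm_eq_abs, Real.norm_eq_abs]
      apply mul_le_mul_of_nonneg_left _ (by positivity)
      rw [rowQ, rowQ]
      refine (Finset.abs_sum_le_sum_abs _ _).trans (Finset.sum_le_sum fun k _ => ?_)
      rw [abs_mul, abs_of_nonneg (hp n k), one_pow]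
      apply mul_le_mul_of_nonneg_left _ (hp n k)
      rw [abs_pow, abs_pow]
      exact pow_le_one₀ (by positivity) (pow_le_one₀ (abs_nonneg _) hu.le)
  have hbd : ∀ N, |∏ i ∈ Finset.range N, serS α (u ^ (i + 1))| ≤ Bd := by
    intro N
    rw [Finset.abs_prod]
    refine le_trans (Finset.prod_le_prod (fun i _ => abs_nonneg _) fun i _ => ?_) (hB N)
    have hsi : Summable fun j => α j * (|u| ^ (i + 1)) ^ j := by
      refine Summable.of_nonneg_of_le (fun j => ?_) (fun j => ?_) hs
      · have := hα j; positivity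
      · apply mul_le_mul_of_nonneg_left _ (hα j)
        exact pow_le_pow_left₀ (by positivity) (pow_le_of_le_one (abs_nonneg _) hu.le (by omega)) j
    rw [serS, serS, ← Real.norm_eq_abs]
    apply tsum_of_norm_bounded hsi.hasSum
    intro j
    rw [norm_mul, norm_pow, norm_pow, Real.norm_eq_abs, Real.norm_eq_abs, abs_of_nonneg (hα j)]
  have hdiff : Tendsto (fun N => (∑' n, u ^ n * rowQ p n 0 - ∑' n, u ^ n * rowQ p n (u ^ N)) *
      ∏ i ∈ Finset.range N, serS α (u ^ (i + 1))) atTop (𝓝 0) := by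
    have h1 : Tendsto (fun N => (∑' n, u ^ n * rowQ p n 0 - ∑' n, u ^ n * rowQ p n (u ^ N))) atTop (𝓝 0) := by
      have := (tendsto_const_nhds (x := ∑' n, u ^ n * rowQ p n 0)).sub hlim
      simpa using this
    apply bdd_le_mul_tendsto_zero' Bd (Eventually.of_forall hbd) h1 |>.congr
    intro N; ring
  have := hdiff.add_const (∑' n, u ^ n * rowQ p n 1)
  rw [zero_add] at this
  have e1 : ∑' n, rowQ p n 1 * u ^ n = ∑' n, u ^ n * rowQ p n 1 := tsum_congr fun n => mul_comm _ _
  rw [e1]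
  refine this.congr fun N => ?_
  rw [hiter N, ← add_mul, sub_add_cancel]
  congr 1
  apply tsum_congr
  intro n
  rw [rowQ_zero]; ring
end abs
end

section
open Filter Topology

section euler
variable {q : ℕ}

lemma glOrder_succ (q j : ℕ) : glOrder q (j + 1) = ((q : ℝ) ^ (j + 1) - 1) * (q : ℝ) ^ j * glOrder q j := by
  rw [glOrder, glOrder, Finset.prod_range_succ', pow_zero, mul_comm, mul_assoc]
  congr 1
  have : ∀ i ∈ Finset.range j, ((q : ℝ) ^ (j + 1) - (q : ℝ) ^ (i + 1)) = q * ((q : ℝ) ^ j - (q : ℝ) ^ i) := by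
    intro i _; ring
  rw [Finset.prod_congr rfl this, Finset.prod_mul_distrib]
  simp

lemma aq_pos (hq : 2 ≤ q) (j : ℕ) : 0 < aq q j := by
  have := glOrder_pos hq j
  have : (0 : ℝ) < q := by exact_mod_cast (by omega : 0 < q)
  rw [aq]; positivity

lemma aq_zero : aq q 0 = 1 := by simp [aq, glOrder]

lemma qinv_lt (hq : 2 ≤ q) : 0 < (q : ℝ)⁻¹ ∧ (q : ℝ)⁻¹ < 1 := by
  have : (1 : ℝ) < q := by exact_mod_cast (by omega : 1 < q)
  exact ⟨by positivity, inv_lt_one_of_one_lt₀ this⟩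

lemma aq_succ (hq : 2 ≤ q) (j : ℕ) : aq q (j + 1) * (1 - (q : ℝ)⁻¹ ^ (j + 1)) = aq q j := by
  have h1 : (1 : ℝ) < q := by exact_mod_cast (by omega : 1 < q)
  have h2 := glOrder_pos hq j
  have h3 : (1 : ℝ) < (q : ℝ) ^ (j + 1) := one_lt_pow₀ h1 (by omega)
  have h4 : (q : ℝ) ^ (j + 1) - 1 ≠ 0 := by linarith
  have h5 : (q : ℝ) ≠ 0 := by linarith
  have h6 : (1 - (q : ℝ)⁻¹ ^ (j + 1)) = ((q : ℝ) ^ (j + 1) - 1) / (q : ℝ) ^ (j + 1) := by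
    rw [inv_pow]; field_simp
  rw [aq, aq, glOrder_succ, h6]
  have h7 := h2.ne'
  field_simp
  ring

lemma aq_summable (hq : 2 ≤ q) {t : ℝ} (ht : |t| < 1) : Summable fun j => aq q j * |t| ^ j := by
  obtain ⟨r, hr1, hr2⟩ := exists_between ht
  apply summable_of_ratio_norm_eventually_le hr2
  have hx := qinv_lt hq
  have h1 : Tendsto (fun j : ℕ => (1 - (q : ℝ)⁻¹ ^ (j + 1))⁻¹ * |t|) atTop (𝓝 ((1 - 0)⁻¹ * |t|)) := by
    apply Tendsto.mul_const
    apply Tendsto.inv₀ _ (by norm_num)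
    apply Tendsto.const_sub
    exact (tendsto_pow_atTop_nhds_zero_of_lt_one hx.1.le hx.2).comp (tendsto_add_atTop_nat 1)
  have h2 := h1.eventually_le_const (u := r) (by simpa using hr1)
  filter_upwards [h2] with j hj
  have h3 : 0 < 1 - (q : ℝ)⁻¹ ^ (j + 1) := by
    have := pow_lt_one₀ hx.1.le hx.2 (n := j + 1) (by omega); linarith
  have h4 := aq_pos hq (j + 1)
  rw [Real.norm_of_nonneg (by positivity), Real.norm_of_nonneg (by have := aq_pos hq j; positivity), ← aq_succ hq j]
  calc aq q (j + 1) * |t| ^ (j + 1) = ((1 - (q : ℝ)⁻¹ ^ (j + 1))⁻¹ * |t|) *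
      (aq q (j + 1) * (1 - (q : ℝ)⁻¹ ^ (j + 1)) * |t| ^ j) := by
        rw [pow_succ |t|]
        generalize 1 - (q : ℝ)⁻¹ ^ (j + 1) = z at h3
        field_simp
    _ ≤ _ := by apply mul_le_mul_of_nonneg_right hj; positivity

lemma aq_summable' (hq : 2 ≤ q) {t : ℝ} (ht : |t| < 1) : Summable fun j => aq q j * t ^ j := by
  refine Summable.of_norm_bounded (aq_summable hq ht) fun j => ?_
  rw [norm_mul, norm_pow, Real.norm_of_nonneg (aq_pos hq j).le, Real.norm_eq_abs]

lemma ser_feq (hq : 2 ≤ q) {t : ℝ} (ht : |t| < 1) :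
    serS (aq q) t * (1 - t) = serS (aq q) (t * (q : ℝ)⁻¹) := by
  have hx := qinv_lt hq
  have ht2 : |t * (q : ℝ)⁻¹| < 1 := by
    rw [abs_mul, abs_of_pos hx.1]
    exact mul_lt_one_of_nonneg_of_lt_one_left (abs_nonneg t) ht hx.2.le
  have s1 := aq_summable' hq ht
  have s2 := aq_summable' hq ht2
  have h : serS (aq q) t - serS (aq q) (t * (q : ℝ)⁻¹) = t * serS (aq q) t := by
    rw [serS, serS, ← s1.tsum_sub s2, (s1.sub s2).tsum_eq_zero_add, ← tsum_mul_left]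
    simp only [pow_zero, sub_self, zero_add]
    apply tsum_congr
    intro j
    rw [← aq_succ hq j, mul_pow]; ring
  linarith

lemma ser_iter (hq : 2 ≤ q) {t : ℝ} (ht : |t| < 1) (N : ℕ) :
    serS (aq q) t * ∏ l ∈ Finset.range N, (1 - t * (q : ℝ)⁻¹ ^ l) = serS (aq q) (t * (q : ℝ)⁻¹ ^ N) := by
  have hx := qinv_lt hq
  induction N with
  | zero => simp
  | succ N ih =>
    rw [Finset.prod_range_succ, ← mul_assoc, ih, ser_feq hq, pow_succ, mul_assoc]
    rw [abs_mul, abs_of_pos (pow_pos hx.1 _)]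
    exact mul_lt_one_of_nonneg_of_lt_one_left (abs_nonneg t) ht (pow_le_one₀ hx.1.le hx.2.le)

lemma ser_tend (hq : 2 ≤ q) {t : ℝ} (ht : |t| < 1) :
    Tendsto (fun N => ∏ l ∈ Finset.range N, (1 - t * (q : ℝ)⁻¹ ^ l)⁻¹) atTop (𝓝 (serS (aq q) t)) := by
  have hx := qinv_lt hq
  have h0 : ∑' j, aq q j * (0 : ℝ) ^ j = 1 := by
    rw [tsum_eq_single 0]
    · simp [aq_zero]
    · intro j hj; simp [hj]
  have h1 : Tendsto (fun N : ℕ => serS (aq q) (t * (q : ℝ)⁻¹ ^ N)) atTop (𝓝 1) := by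
    rw [← h0]
    apply tendsto_tsum_of_dominated_convergence (aq_summable hq ht)
    · intro j
      apply Tendsto.const_mul
      apply Tendsto.pow
      have := (tendsto_pow_atTop_nhds_zero_of_lt_one hx.1.le hx.2).const_mul t
      simpa using this
    · refine Eventually.of_forall fun N j => ?_
      rw [norm_mul, norm_pow, Real.norm_of_nonneg (aq_pos hq j).le, Real.norm_eq_abs]
      apply mul_le_mul_of_nonneg_left _ (aq_pos hq j).le
      apply pow_le_pow_left₀ (abs_nonneg _)
      rw [abs_mul, abs_of_pos (pow_pos hx.1 _)]
      exact mul_le_of_le_one_right (abs_nonneg t) (pow_le_one₀ hx.1.le hx.2.le)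
  have h2 : Tendsto (fun N : ℕ => serS (aq q) t / serS (aq q) (t * (q : ℝ)⁻¹ ^ N)) atTop (𝓝 (serS (aq q) t / 1)) :=
    tendsto_const_nhds.div h1 one_ne_zero
  rw [div_one] at h2
  refine h2.congr' ?_
  filter_upwards [h1.eventually_ne one_ne_zero] with N hN
  rw [← ser_iter hq ht N] at hN ⊢
  have := left_ne_zero_of_mul hN
  rw [Finset.prod_inv_distrib]
  field_simp

lemma inv_aux (y : ℝ) (h : 1 - y ≠ 0) : 1 + y / (1 - y) = (1 - y)⁻¹ := by
  field_simp
  ring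

/-- multipliability of the double product -/
lemma mult_f (hq : 2 ≤ q) {s u : ℝ} (hu : |u| < 1) (hsu : |s * u| < 1) :
    Multipliable fun il : ℕ × ℕ => (1 - s * u ^ (il.1 + 1) * (q : ℝ)⁻¹ ^ il.2)⁻¹ := by
  have hx := qinv_lt hq
  set x : ℕ × ℕ → ℝ := fun il => s * u ^ (il.1 + 1) * (q : ℝ)⁻¹ ^ il.2 with hxd
  have hxb : ∀ il, |x il| ≤ |s * u| := by
    intro il
    have : x il = s * u * (u ^ il.1 * (q : ℝ)⁻¹ ^ il.2) := by simp only [hxd]; ring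
    rw [this, abs_mul (s * u)]
    apply mul_le_of_le_one_right (abs_nonneg _)
    rw [abs_mul, abs_pow, abs_pow, abs_of_pos hx.1]
    exact mul_le_one₀ (pow_le_one₀ (abs_nonneg _) hu.le) (by have := hx.1; positivity) (pow_le_one₀ hx.1.le hx.2.le)
  have hsum : Summable fun il => |x il| := by
    have h1 : Summable fun i : ℕ => |s * u| * |u| ^ i :=
      (summable_geometric_of_lt_one (abs_nonneg _) hu).mul_left _
    have h2 : Summable fun l : ℕ => (q : ℝ)⁻¹ ^ l := summable_geometric_of_lt_one hx.1.le hx.2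
    refine (h1.mul_of_nonneg h2 (fun i => by positivity) (fun l => by have := hx.1; positivity)).congr fun il => ?_
    have : x il = s * u * u ^ il.1 * (q : ℝ)⁻¹ ^ il.2 := by simp only [hxd]; ring
    rw [this, abs_mul _ ((q : ℝ)⁻¹ ^ il.2), abs_mul _ (u ^ il.1), abs_pow, abs_pow, abs_of_pos hx.1]
  have hpos : ∀ il, 1 - |s * u| ≤ 1 - x il := fun il => by
    have := (le_abs_self _).trans (hxb il); linarith
  have h3 : Multipliable fun il => (1 + x il / (1 - x il)) := by
    apply Real.multipliable_one_add_of_summable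
    refine Summable.of_norm_bounded (hsum.mul_right (1 - |s * u|)⁻¹) fun il => ?_
    have h4 := hpos il
    have h5 : 0 < 1 - |s * u| := by linarith
    rw [Real.norm_eq_abs, abs_div, div_eq_mul_inv]
    apply mul_le_mul_of_nonneg_left _ (abs_nonneg _)
    apply inv_anti₀ h5
    exact h4.trans (le_abs_self _)
  refine h3.congr fun il => ?_
  have h4 := hpos il
  have h5 : 1 - x il ≠ 0 := by linarith
  exact inv_aux _ h5

lemma prod_a (hq : 2 ≤ q) {s u : ℝ} (hu : |u| < 1) (hsu : |s * u| < 1) :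
    HasProd (fun i : ℕ => serS (aq q) (s * u ^ (i + 1)))
      (∏' il : ℕ × ℕ, (1 - s * u ^ (il.1 + 1) * (q : ℝ)⁻¹ ^ il.2)⁻¹) := by
  have hx := qinv_lt hq
  refine (mult_f hq hu hsu).hasProd.prod_fiberwise fun i => ?_
  have hti : |s * u ^ (i + 1)| < 1 := by
    rw [pow_succ', ← mul_assoc, abs_mul, abs_pow]
    exact mul_lt_one_of_nonneg_of_lt_one_left (abs_nonneg _) hsu (pow_le_one₀ (abs_nonneg _) hu.le)
  have hm : Multipliable fun l : ℕ => (1 - s * u ^ (i + 1) * (q : ℝ)⁻¹ ^ l)⁻¹ := by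
    have h1 := mult_f hq (s := s * u ^ (i + 1)) (u := (q : ℝ)⁻¹) (by rw [abs_of_pos hx.1]; exact hx.2) (by
      rw [abs_mul, abs_of_pos hx.1]
      exact mul_lt_one_of_nonneg_of_lt_one_left (abs_nonneg _) hti hx.2.le)
    have h3 : Summable fun l : ℕ => |s * u ^ (i + 1) * (q : ℝ)⁻¹ ^ l| := by
      refine ((summable_geometric_of_lt_one hx.1.le hx.2).mul_left |s * u ^ (i + 1)|).congr fun l => ?_
      rw [abs_mul _ ((q : ℝ)⁻¹ ^ l), abs_pow _ l, abs_of_pos hx.1]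
    have hb : ∀ l : ℕ, 1 - |s * u ^ (i + 1)| ≤ 1 - s * u ^ (i + 1) * (q : ℝ)⁻¹ ^ l := by
      intro l
      have : |s * u ^ (i + 1) * (q : ℝ)⁻¹ ^ l| ≤ |s * u ^ (i + 1)| := by
        rw [abs_mul _ ((q : ℝ)⁻¹ ^ l), abs_pow _ l, abs_of_pos hx.1]
        exact mul_le_of_le_one_right (abs_nonneg _) (pow_le_one₀ hx.1.le hx.2.le)
      have := (le_abs_self _).trans this
      linarith
    have h4 : Multipliable fun l : ℕ => (1 + (s * u ^ (i + 1) * (q : ℝ)⁻¹ ^ l) / (1 - s * u ^ (i + 1) * (q : ℝ)⁻¹ ^ l)) := by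
      apply Real.multipliable_one_add_of_summable
      refine Summable.of_norm_bounded (h3.mul_right (1 - |s * u ^ (i + 1)|)⁻¹) fun l => ?_
      have h4 := hb l
      have h5 : 0 < 1 - |s * u ^ (i + 1)| := by linarith
      rw [Real.norm_eq_abs, abs_div, div_eq_mul_inv]
      apply mul_le_mul_of_nonneg_left _ (abs_nonneg _)
      apply inv_anti₀ h5
      exact h4.trans (le_abs_self _)
    refine h4.congr fun l => ?_
    have h4 := hb l
    have h5 : 1 - s * u ^ (i + 1) * (q : ℝ)⁻¹ ^ l ≠ 0 := by linarith
    exact inv_aux _ h5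
  have e := tendsto_nhds_unique hm.hasProd.tendsto_prod_nat (ser_tend hq hti)
  rw [← e]
  exact hm.hasProd

lemma serS_geom {w : ℝ} (hw : |(q : ℝ) * w| < 1) : serS (fun j => (q : ℝ) ^ j) w = (1 - q * w)⁻¹ := by
  rw [serS]
  simp_rw [← mul_pow]
  exact tsum_geometric_of_abs_lt_one hw

lemma tend_bdd {f : ℕ → ℝ} {a : ℝ} (h : Tendsto f atTop (𝓝 a)) : ∃ B, ∀ n, f n ≤ B := by
  obtain ⟨B, hB⟩ := h.bddAbove_range
  exact ⟨B, fun n => hB ⟨n, rfl⟩⟩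

lemma ser_ne (hq : 2 ≤ q) {t : ℝ} (ht : 0 ≤ t) (ht1 : t < 1) : 1 ≤ serS (aq q) t := by
  have := (aq_summable' hq (t := t) (by rwa [abs_of_nonneg ht])).le_tsum 0 fun j _ => by
    have := aq_pos hq j; positivity
  rw [serS]
  simpa [aq_zero] using this

theorem analytic_final (hq : 2 ≤ q) (u : ℝ) (hu : |u| < 1 / q) (p c : ℕ → ℕ → ℝ)
    (hp : ∀ n k, 0 ≤ p n k) (hz : ∀ n k, n < k → p n k = 0)
    (hrec : ∀ m k, p (m + k) k = ∑ x ∈ Finset.HasAntidiagonal.antidiagonal k, p m x.1 * aq q x.2)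
    (hc : ∀ n k, 0 ≤ c n k) (hcz : ∀ n k, n < k → c n k = 0)
    (hcrec : ∀ m k, c (m + k) k = ∑ x ∈ Finset.HasAntidiagonal.antidiagonal k, c m x.1 * (q : ℝ) ^ x.2)
    (hc0 : ∀ n, c n 0 = if n = 0 then 1 else 0)
    (hpc : ∀ n, p n 0 = rowQ c n 1) :
    Summable (fun n : ℕ => rowQ p n 1 * u ^ n) ∧
    Multipliable (fun il : ℕ × ℕ =>
      (1 - u ^ (il.1 + 1) * (q : ℝ) ^ ((1 : ℤ) - il.2))⁻¹) ∧
    ∑' n : ℕ, rowQ p n 1 * u ^ n =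
      ∏' il : ℕ × ℕ, (1 - u ^ (il.1 + 1) * (q : ℝ) ^ ((1 : ℤ) - il.2))⁻¹ := by
  have hx := qinv_lt hq
  have hq1 : (1 : ℝ) < q := by exact_mod_cast (by omega : 1 < q)
  have hq0 : (0 : ℝ) < q := by linarith
  have hu1 : |u| < 1 := by
    refine hu.trans_le ?_
    rw [one_div]; exact hx.2.le
  have hqu : |(q : ℝ) * u| < 1 := by
    rw [abs_mul, abs_of_pos hq0]
    rw [lt_div_iff₀ hq0] at hu
    linarith
  have hua : |(|u|)| < 1 := by rwa [abs_abs]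
  have hqua : |(q : ℝ) * (|u|)| < 1 := by rw [abs_mul, abs_abs, ← abs_mul]; exact hqu
  have hti : ∀ v : ℝ, |v| < 1 → |(q : ℝ) * v| < 1 → ∀ i : ℕ, |(q : ℝ) * v ^ (i + 1)| < 1 := by
    intro v hv1 hv2 i
    rw [pow_succ', ← mul_assoc, abs_mul, abs_pow]
    exact mul_lt_one_of_nonneg_of_lt_one_left (abs_nonneg _) hv2 (pow_le_one₀ (abs_nonneg _) hv1.le)
  have hti1 : ∀ v : ℝ, |v| < 1 → ∀ i : ℕ, |v ^ (i + 1)| < 1 := by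
    intro v hv i
    rw [abs_pow]; exact pow_lt_one₀ (abs_nonneg _) hv (by omega)
  have hA : ∀ v : ℝ, |v| < 1 → |(q : ℝ) * v| < 1 →
      Tendsto (fun N => ∏ i ∈ Finset.range N, serS (aq q) (v ^ (i + 1))) atTop
      (𝓝 (∏' il : ℕ × ℕ, (1 - 1 * v ^ (il.1 + 1) * (q : ℝ)⁻¹ ^ il.2)⁻¹)) := by
    intro v hv1 hv2
    have := (prod_a hq (s := 1) (u := v) hv1 (by rwa [one_mul])).tendsto_prod_nat
    simpa only [one_mul] using this
  have hAq : ∀ v : ℝ, |v| < 1 → |(q : ℝ) * v| < 1 →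
      Tendsto (fun N => ∏ i ∈ Finset.range N, serS (aq q) ((q : ℝ) * v ^ (i + 1))) atTop
      (𝓝 (∏' il : ℕ × ℕ, (1 - (q : ℝ) * v ^ (il.1 + 1) * (q : ℝ)⁻¹ ^ il.2)⁻¹)) := by
    intro v hv1 hv2
    exact (prod_a hq (s := (q : ℝ)) (u := v) hv1 hv2).tendsto_prod_nat
  -- relation
  have hrel : ∀ v : ℝ, |v| < 1 → |(q : ℝ) * v| < 1 → ∀ i : ℕ,
      serS (fun j => (q : ℝ) ^ j) (v ^ (i + 1)) * serS (aq q) (v ^ (i + 1)) = serS (aq q) ((q : ℝ) * v ^ (i + 1)) := by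
    intro v hv1 hv2 i
    have h1 := hti v hv1 hv2 i
    rw [serS_geom h1]
    have h2 := ser_feq hq h1
    have h3 : (q : ℝ) * v ^ (i + 1) * (q : ℝ)⁻¹ = v ^ (i + 1) := by field_simp
    rw [h3] at h2
    have h4 : 1 - (q : ℝ) * v ^ (i + 1) ≠ 0 := by
      have := (abs_lt.1 h1).2; linarith
    rw [← h2]; field_simp
  obtain ⟨B1, hB1⟩ := tend_bdd (hA |u| hua hqua)
  obtain ⟨B2, hB2⟩ := tend_bdd (hAq |u| hua hqua)
  -- the class series
  have hcs : Summable fun n => c n 0 * |u| ^ n := by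
    apply summable_of_ne_finset_zero (s := {0})
    intro n hn
    rw [hc0, if_neg (by simpa using hn)]; simp
  have hgs : Summable fun j => (q : ℝ) ^ j * |u| ^ j := by
    simp_rw [← mul_pow]
    exact summable_geometric_of_abs_lt_one hqua
  obtain ⟨c1, c2⟩ := abs_main hc (fun j => by positivity) hcz hcrec u hu1 hgs hcs B2 (by
    intro N
    refine le_trans (Finset.prod_le_prod (fun i _ => ?_) fun i _ => ?_) (hB2 N)
    · exact tsum_nonneg fun j => by positivity
    · rw [← hrel |u| hua hqua]
      apply le_mul_of_one_le_right
      · exact tsum_nonneg fun j => by positivity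
      · apply ser_ne hq (by positivity)
        exact (le_abs_self _).trans_lt (hti1 _ hua i))
  have hc1 : ∑' n, c n 0 * u ^ n = 1 := by
    rw [tsum_eq_single 0]
    · simp [hc0]
    · intro n hn; rw [hc0, if_neg hn]; simp
  simp only [hc1, one_mul] at c2
  obtain ⟨d1, d2⟩ := abs_main hp (fun j => (aq_pos hq j).le) hz hrec u hu1 (aq_summable hq hu1)
    (by simp only [hpc]; exact c1) B1 hB1
  simp only [hpc] at d2
  have hf : (fun il : ℕ × ℕ => (1 - u ^ (il.1 + 1) * (q : ℝ) ^ ((1 : ℤ) - il.2))⁻¹) =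
      fun il : ℕ × ℕ => (1 - (q : ℝ) * u ^ (il.1 + 1) * (q : ℝ)⁻¹ ^ il.2)⁻¹ := by
    funext il
    congr 2
    rw [zpow_sub₀ hq0.ne', zpow_one, zpow_natCast, inv_pow]
    ring
  rw [hf]
  refine ⟨?_, mult_f hq hu1 hqu, ?_⟩
  · refine Summable.of_norm_bounded d1 fun n => ?_
    rw [norm_mul, norm_pow, Real.norm_eq_abs, Real.norm_eq_abs, abs_of_nonneg]
    rw [rowQ]
    exact Finset.sum_nonneg fun k _ => by have := hp n k; simpa using this
  · have e1 := tendsto_nhds_unique d2 ((hA u hu1 hqu).const_mul _)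
    rw [e1]
    refine tendsto_nhds_unique (c2.mul (hA u hu1 hqu)) ?_
    refine (hAq u hu1 hqu).congr fun N => ?_
    rw [← Finset.prod_mul_distrib]
    exact Finset.prod_congr rfl fun i _ => (hrel u hu1 hqu i).symm
end euler
end

section
open Polynomial

section classify
set_option linter.unusedSectionVars false
/-- monic irreducible polynomials -/
abbrev MIr (F : Type) [Field F] : Type := {p : F[X] // p.Monic ∧ Irreducible p}

variable {F : Type} [Field F]

/-- elementary cyclic module -/
abbrev Cyc (x : MIr F × ℕ) : Type := F[X] ⧸ Ideal.span {x.1.1 ^ (x.2 + 1)}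

lemma reindex {ι κ α : Type} [Fintype ι] [Fintype κ] (f : ι → α) (g : κ → α)
    (h : Finset.univ.val.map f = Finset.univ.val.map g) : ∃ σ : ι ≃ κ, ∀ i, g (σ i) = f i := by
  classical
  have hc : ∀ a, Nonempty ({i // f i = a} ≃ {j // g j = a}) := by
    intro a
    apply Fintype.card_eq.1
    have := congrArg (Multiset.count a) h
    rw [Multiset.count_map, Multiset.count_map] at this
    rw [Fintype.card_subtype, Fintype.card_subtype]
    simp only [Finset.card_def, Finset.filter_val]
    convert this using 3 <;> exact eq_comm
  let e := fun a => (hc a).some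
  refine ⟨(Equiv.sigmaFiberEquiv f).symm.trans ((Equiv.sigmaCongrRight e).trans (Equiv.sigmaFiberEquiv g)), fun i => ?_⟩
  exact (e (f i) ⟨i, rfl⟩).2

/-- the F[X]-module of type `s` -/
def HasT (M : Type) [AddCommGroup M] [Module F[X] M] (s : Multiset (MIr F × ℕ)) : Prop :=
  ∃ (ι : Type) (_ : Fintype ι) (f : ι → MIr F × ℕ), Finset.univ.val.map f = s ∧
    Nonempty (M ≃ₗ[F[X]] (∀ i, Cyc (f i)))

lemma HasT.congr {M N : Type} [AddCommGroup M] [Module F[X] M] [AddCommGroup N] [Module F[X] N]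
    {s : Multiset (MIr F × ℕ)} (h : HasT M s) (e : M ≃ₗ[F[X]] N) : HasT N s := by
  obtain ⟨ι, i1, f, hf, ⟨e'⟩⟩ := h
  exact ⟨ι, i1, f, hf, ⟨e.symm.trans e'⟩⟩

lemma HasT.iso {M N : Type} [AddCommGroup M] [Module F[X] M] [AddCommGroup N] [Module F[X] N]
    {s : Multiset (MIr F × ℕ)} (h : HasT M s) (h' : HasT N s) : Nonempty (M ≃ₗ[F[X]] N) := by
  obtain ⟨ι, i1, f, hf, ⟨e⟩⟩ := h
  obtain ⟨κ, i2, g, hg, ⟨e'⟩⟩ := h'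
  obtain ⟨σ, hσ⟩ := reindex f g (hf.trans hg.symm)
  have hfg : f = fun i => g (σ i) := funext fun i => (hσ i).symm
  subst hfg
  exact ⟨e.trans ((LinearEquiv.piCongrLeft F[X] (fun j => Cyc (g j)) σ).trans e'.symm)⟩

lemma exists_monic {p : F[X]} (hp : Irreducible p) : ∃ φ : MIr F, Associated p φ.1 := by
  have h := hp.ne_zero
  refine ⟨⟨p * C p.leadingCoeff⁻¹, monic_mul_leadingCoeff_inv h, ?_⟩, ?_⟩
  · exact (associated_mul_unit_right p _ (isUnit_C.2 (by simpa using h))).irreducible hp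
  · exact associated_mul_unit_right p _ (isUnit_C.2 (by simpa using h))

lemma exists_type {M : Type} [AddCommGroup M] [Module F[X] M] [Module.Finite F[X] M]
    (hM : Module.IsTorsion F[X] M) : ∃ s : Multiset (MIr F × ℕ), HasT M s := by
  classical
  obtain ⟨ι, i1, p, hp, e, ⟨E⟩⟩ := Module.equiv_directSum_of_isTorsion hM
  choose φ hφ using fun i => exists_monic (hp i)
  let κ := {i // e i ≠ 0}
  let f : κ → MIr F × ℕ := fun i => (φ i.1, e i.1 - 1)
  refine ⟨_, κ, inferInstance, f, rfl, ?_⟩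
  let E1 := DirectSum.linearEquivFunOnFintype F[X] ι (fun i => F[X] ⧸ Submodule.span F[X] {p i ^ e i})
  let T : (∀ i, F[X] ⧸ Submodule.span F[X] {p i ^ e i}) →ₗ[F[X]]
      (∀ i : κ, F[X] ⧸ Submodule.span F[X] {p i.1 ^ e i.1}) :=
    LinearMap.pi fun i => LinearMap.proj i.1
  have hT : Function.Bijective T := by
    constructor
    · intro x y h
      funext i
      by_cases hi : e i = 0
      · have : Subsingleton (F[X] ⧸ Submodule.span F[X] {p i ^ e i}) := by
          rw [Submodule.Quotient.subsingleton_iff, hi, pow_zero]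
          exact Ideal.span_singleton_one
        exact Subsingleton.elim _ _
      · exact congrFun h ⟨i, hi⟩
    · intro y
      refine ⟨fun i => if hi : e i ≠ 0 then y ⟨i, hi⟩ else 0, ?_⟩
      funext i
      simp only [T, LinearMap.pi_apply, LinearMap.proj_apply]
      rw [dif_pos i.2]
  have E3 : (∀ i : κ, F[X] ⧸ Submodule.span F[X] {p i.1 ^ e i.1}) ≃ₗ[F[X]] ∀ i, Cyc (f i) := by
    refine LinearEquiv.piCongrRight fun i => ?_
    apply Submodule.quotEquivOfEq
    change Ideal.span {p i.1 ^ e i.1} = Ideal.span {(φ i.1).1 ^ (e i.1 - 1 + 1)}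
    rw [Ideal.span_singleton_eq_span_singleton, Nat.sub_add_cancel (Nat.pos_of_ne_zero i.2)]
    exact (hφ i.1).pow_pow
  exact ⟨E.trans (E1.trans ((LinearEquiv.ofBijective T hT).trans E3))⟩

/-- rank exponent -/
noncomputable def rk [DecidableEq (MIr F)] (φ : MIr F) (j : ℕ) (x : MIr F × ℕ) : ℕ :=
  if x.1 = φ then φ.1.natDegree * (x.2 + 1 - j) else x.1.1.natDegree * (x.2 + 1)

lemma finrank_quot {f : F[X]} (hf : f ≠ 0) :
    Module.finrank F (F[X] ⧸ Ideal.span {f}) = f.natDegree ∧ Module.Finite F (F[X] ⧸ Ideal.span {f}) := by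
  exact ⟨finrank_quotient_span_eq_natDegree, (AdjoinRoot.powerBasis hf).finite⟩

variable [Fintype F]

lemma card_quot {f : F[X]} (hf : f ≠ 0) :
    Nat.card (F[X] ⧸ Ideal.span {f}) = Fintype.card F ^ f.natDegree := by
  obtain ⟨h1, h2⟩ := finrank_quot hf
  rw [← h1, Module.natCard_eq_pow_finrank (K := F), Nat.card_eq_fintype_card]

lemma dvd_aux [DecidableEq (MIr F)] (φ : MIr F) (j : ℕ) (x : MIr F × ℕ) : ∃ g : F[X], g ≠ 0 ∧ g.natDegree = rk φ j x ∧
    ∀ p : F[X], x.1.1 ^ (x.2 + 1) ∣ φ.1 ^ j * p ↔ g ∣ p := by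
  rw [rk]
  split_ifs with h
  · refine ⟨φ.1 ^ (x.2 + 1 - j), pow_ne_zero _ φ.2.2.ne_zero, by rw [φ.2.1.natDegree_pow]; ring, fun p => ?_⟩
    rw [h]
    by_cases hj : j ≤ x.2 + 1
    · conv_lhs => rw [← Nat.add_sub_cancel' hj, pow_add]
      exact mul_dvd_mul_iff_left (pow_ne_zero _ φ.2.2.ne_zero)
    · have : x.2 + 1 - j = 0 := by omega
      rw [this, pow_zero]
      simp only [one_dvd, iff_true]
      exact (pow_dvd_pow _ (by omega)).mul_right p
  · refine ⟨x.1.1 ^ (x.2 + 1), pow_ne_zero _ x.1.2.2.ne_zero, by rw [x.1.2.1.natDegree_pow]; ring, fun p => ?_⟩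
    have hcop : IsCoprime (x.1.1 ^ (x.2 + 1)) (φ.1 ^ j) := by
      apply IsCoprime.pow
      rw [x.1.2.2.coprime_iff_not_dvd]
      intro hd
      apply h
      have := x.1.2.2.associated_of_dvd φ.2.2 hd
      exact Subtype.ext (eq_of_monic_of_associated x.1.2.1 φ.2.1 this)
    constructor
    · exact hcop.dvd_of_dvd_mul_left
    · exact fun h => h.mul_left _

lemma card_range_cyc [DecidableEq (MIr F)] (φ : MIr F) (j : ℕ) (x : MIr F × ℕ) :
    Nat.card {y : Cyc x // ∃ z, φ.1 ^ j • z = y} = Fintype.card F ^ rk φ j x := by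
  obtain ⟨g, hg, hd, hdvd⟩ := dvd_aux φ j x
  let T : F[X] →ₗ[F[X]] Cyc x := (Submodule.mkQ _).comp (LinearMap.lsmul F[X] F[X] (φ.1 ^ j))
  have hk : LinearMap.ker T = Ideal.span {g} := by
    ext p
    simp only [T, LinearMap.mem_ker, LinearMap.comp_apply, LinearMap.lsmul_apply, smul_eq_mul,
      Submodule.mkQ_apply, Submodule.Quotient.mk_eq_zero]
    rw [Ideal.mem_span_singleton, Ideal.mem_span_singleton, hdvd]
  rw [← hd, ← card_quot hg]
  have e := T.quotKerEquivRange
  rw [hk] at e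
  rw [Nat.card_congr e.toEquiv]
  apply Nat.card_congr
  apply Equiv.subtypeEquivRight
  intro y
  simp only [T, LinearMap.mem_range, LinearMap.comp_apply, LinearMap.lsmul_apply]
  constructor
  · rintro ⟨z, hz⟩
    obtain ⟨w, rfl⟩ := Submodule.mkQ_surjective _ z
    exact ⟨w, by rw [← hz, map_smul]⟩
  · rintro ⟨w, hw⟩
    exact ⟨Submodule.mkQ _ w, by rw [← hw, map_smul]⟩

lemma card_range_T [DecidableEq (MIr F)] {M : Type} [AddCommGroup M] [Module F[X] M] {s : Multiset (MIr F × ℕ)} (h : HasT M s) (φ : MIr F) (j : ℕ) :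
    Nat.card {y : M // ∃ z, φ.1 ^ j • z = y} = Fintype.card F ^ (s.map (rk φ j)).sum := by
  obtain ⟨ι, i1, f, hf, ⟨e⟩⟩ := h
  have : Nat.card {y : M // ∃ z, φ.1 ^ j • z = y} =
      Nat.card (∀ i, {y : Cyc (f i) // ∃ z, φ.1 ^ j • z = y}) := by
    apply Nat.card_congr
    refine Equiv.trans (Equiv.subtypeEquiv e.toEquiv (q := fun y => ∀ i, ∃ z, φ.1 ^ j • z = y i) fun y => ?_)
      (Equiv.subtypePiEquivPi (p := fun i (y : Cyc (f i)) => ∃ z, φ.1 ^ j • z = y))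
    constructor
    · rintro ⟨z, rfl⟩ i
      exact ⟨e z i, by simp⟩
    · intro H
      choose z hz using H
      refine ⟨e.symm z, e.injective ?_⟩
      rw [map_smul, e.apply_symm_apply]
      funext i
      exact hz i
  rw [this, Nat.card_pi]
  simp_rw [card_range_cyc]
  rw [Finset.prod_pow_eq_pow_sum, ← hf, Multiset.map_map]
  rfl

lemma rk_second [DecidableEq (MIr F)] (φ : MIr F) (j : ℕ) (s : Multiset (MIr F × ℕ)) :
    φ.1.natDegree * s.count (φ, j) + 2 * (s.map (rk φ (j + 1))).sum =
      (s.map (rk φ j)).sum + (s.map (rk φ (j + 2))).sum := by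
  induction s using Multiset.induction_on with
  | empty => simp
  | cons x s ih =>
    rw [Multiset.count_cons]
    simp only [Multiset.map_cons, Multiset.sum_cons]
    have : φ.1.natDegree * (if (φ, j) = x then 1 else 0) + 2 * rk φ (j + 1) x = rk φ j x + rk φ (j + 2) x := by
      obtain ⟨ψ, e⟩ := x
      simp only [rk, Prod.mk.injEq]
      by_cases h : ψ = φ
      · subst h
        simp only [true_and, if_true]
        rcases lt_trichotomy j e with hj | hj | hj
        · obtain ⟨d, rfl⟩ : ∃ d, e = j + 1 + d := ⟨e - (j + 1), by omega⟩
          rw [if_neg (by omega)]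
          have h1 : j + 1 + d + 1 - (j + 1) = d + 1 := by omega
          have h2 : j + 1 + d + 1 - j = d + 2 := by omega
          have h3 : j + 1 + d + 1 - (j + 2) = d := by omega
          rw [h1, h2, h3]; ring
        · subst hj
          have h1 : j + 1 - (j + 1) = 0 := by omega
          have h2 : j + 1 - j = 1 := by omega
          have h3 : j + 1 - (j + 2) = 0 := by omega
          rw [h1, h2, h3]; simp
        · rw [if_neg (by omega)]
          have h1 : e + 1 - (j + 1) = 0 := by omega
          have h2 : e + 1 - j = 0 := by omega
          have h3 : e + 1 - (j + 2) = 0 := by omega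
          rw [h1, h2, h3]; simp
      · have h' : ¬ φ = ψ := fun h2 => h h2.symm
        simp only [h, h', false_and, if_false]; ring
    linarith

lemma HasT.unique {M : Type} [AddCommGroup M] [Module F[X] M] {s t : Multiset (MIr F × ℕ)} (h : HasT M s) (h' : HasT M t) :
    s = t := by
  classical
  have hr : ∀ (φ : MIr F) j, (s.map (rk φ j)).sum = (t.map (rk φ j)).sum := by
    intro φ j
    have := (card_range_T h φ j).symm.trans (card_range_T h' φ j)
    exact Nat.pow_right_injective Fintype.one_lt_card this
  ext ⟨φ, j⟩
  have h1 := rk_second φ j s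
  have h2 := rk_second φ j t
  rw [hr, hr, hr] at h1
  have h3 : φ.1.natDegree * s.count (φ, j) = φ.1.natDegree * t.count (φ, j) := by omega
  exact Nat.eq_of_mul_eq_mul_left φ.2.2.natDegree_pos h3

/-- weight -/
def wt (s : Multiset (MIr F × ℕ)) : ℕ := (s.map fun x => x.1.1.natDegree * (x.2 + 1)).sum

lemma exists_mod (s : Multiset (MIr F × ℕ)) : ∃ (M : Type) (_ : AddCommGroup M) (_ : Module F[X] M)
    (_ : Module F M) (_ : IsScalarTower F F[X] M), HasT M s ∧ Module.Finite F M ∧ Module.finrank F M = wt s := by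
  let f : Fin s.toList.length → MIr F × ℕ := s.toList.get
  have hf : Finset.univ.val.map f = s := by
    conv_rhs => rw [← Multiset.coe_toList s]
    rw [Fin.univ_val_map, List.ofFn_get]
  refine ⟨∀ i, Cyc (f i), inferInstance, inferInstance, inferInstance, inferInstance,
    ⟨_, inferInstance, f, hf, ⟨LinearEquiv.refl _ _⟩⟩, ?_⟩
  have hne : ∀ i, ((f i).1.1 ^ ((f i).2 + 1)) ≠ 0 := fun i => pow_ne_zero _ (f i).1.2.2.ne_zero
  have : ∀ i, Module.Finite F (Cyc (f i)) := fun i => (finrank_quot (hne i)).2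
  refine ⟨inferInstance, ?_⟩
  rw [Module.finrank_pi_fintype, wt]
  conv_rhs => rw [← hf, Multiset.map_map]
  refine Finset.sum_congr rfl fun i _ => ?_
  rw [(finrank_quot (hne i)).1, (f i).1.2.1.natDegree_pow]
  simp only [Function.comp_apply]
  ring

lemma HasT.card {M : Type} [AddCommGroup M] [Module F[X] M] {s : Multiset (MIr F × ℕ)} (h : HasT M s) :
    Nat.card M = Fintype.card F ^ wt s := by
  obtain ⟨N, i1, i2, i3, i4, hN, hf, hr⟩ := exists_mod s
  obtain ⟨e⟩ := h.iso hN
  rw [Nat.card_congr e.toEquiv, Module.natCard_eq_pow_finrank (K := F), Nat.card_eq_fintype_card, hr]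

end classify
end

section
open Polynomial

section burn
variable (F : Type) [Field F] [Fintype F]

/-- endomorphisms -/
abbrev En (n : ℕ) : Type := Module.End F (Fin n → F)

variable {F}

lemma hasT_exists {n : ℕ} (A : En F n) : ∃ s : Multiset (MIr F × ℕ), HasT (Module.AEval' A) s :=
  exists_type (Module.AEval.isTorsion_of_finiteDimensional F (Fin n → F) A)

lemma hasT_wt {n : ℕ} (A : En F n) {s : Multiset (MIr F × ℕ)} (h : HasT (Module.AEval' A) s) : wt s = n := by
  have h1 := h.card
  have h2 : Nat.card (Module.AEval' A) = Fintype.card F ^ n := by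
    rw [Nat.card_congr (Module.AEval'.of A).symm.toEquiv]
    simp
  rw [h2] at h1
  exact (Nat.pow_right_injective Fintype.one_lt_card h1).symm

lemma hasT_real {n : ℕ} (s : Multiset (MIr F × ℕ)) (h : wt s = n) : ∃ A : En F n, HasT (Module.AEval' A) s := by
  obtain ⟨M, i1, i2, i3, i4, hT, hf, hr⟩ := exists_mod s
  have e : (Fin n → F) ≃ₗ[F] M := LinearEquiv.ofFinrankEq _ _ (by rw [hr, h]; simp)
  let A : En F n := e.symm.toLinearMap ∘ₗ (Algebra.lsmul F F M (X : F[X])) ∘ₗ e.toLinearMap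
  refine ⟨A, hT.congr ?_⟩
  refine (LinearEquiv.ofAEval A e fun m => ?_).symm
  simp [A]

lemma conj_iff {n : ℕ} (A B : En F n) :
    Nonempty (Module.AEval' A ≃ₗ[F[X]] Module.AEval' B) ↔ A ∈ MulAction.orbit (ConjAct (En F n)ˣ) B := by
  constructor
  · rintro ⟨e⟩
    let e0 : (Fin n → F) ≃ₗ[F] (Fin n → F) :=
      (Module.AEval'.of A).trans ((e.restrictScalars F).trans (Module.AEval'.of B).symm)
    have he : ∀ m, e0 (A m) = B (e0 m) := by
      intro m
      have h1 := e.map_smul (X : F[X]) (Module.AEval'.of A m)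
      rw [Module.AEval'.X_smul_of] at h1
      have h2 := Module.AEval.of_symm_X_smul (R := F) B (e (Module.AEval'.of A m))
      rw [← h1] at h2
      exact h2
    let g : (En F n)ˣ := (LinearMap.GeneralLinearGroup.generalLinearEquiv F (Fin n → F)).symm e0
    refine ⟨ConjAct.toConjAct g⁻¹, ?_⟩
    change ConjAct.toConjAct g⁻¹ • B = A
    rw [ConjAct.units_smul_def, ConjAct.ofConjAct_toConjAct, inv_inv]
    have h3 : B * (g : En F n) = g * A := by
      ext1 m
      exact LinearMap.ext fun t => (he _).symm
    rw [mul_assoc, h3, ← mul_assoc]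
    simp
  · rintro ⟨g, hg⟩
    change g • B = A at hg
    rw [ConjAct.units_smul_def] at hg
    have h3 : (↑(ConjAct.ofConjAct g)⁻¹ : En F n) * A = B * ↑(ConjAct.ofConjAct g)⁻¹ := by
      rw [← hg, ← mul_assoc, ← mul_assoc]; simp
    let e0 := LinearMap.GeneralLinearGroup.generalLinearEquiv F (Fin n → F) (ConjAct.ofConjAct g)⁻¹
    refine ⟨LinearEquiv.ofAEval _ (e0.trans (Module.AEval'.of B)) fun m => ?_⟩
    have := LinearMap.congr_fun h3 m
    simp only [LinearEquiv.trans_apply, Module.AEval'.X_smul_of]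
    congr 1

/-- types of weight n -/
abbrev Ty (F : Type) [Field F] [Fintype F] (n : ℕ) : Type := {s : Multiset (MIr F × ℕ) // wt s = n}

lemma orbits_types (n : ℕ) :
    Nonempty (MulAction.orbitRel.Quotient (ConjAct (En F n)ˣ) (En F n) ≃ Ty F n) := by
  choose ty hty using fun A : En F n => hasT_exists A
  have key : ∀ A B : En F n, ty A = ty B ↔ A ∈ MulAction.orbit (ConjAct (En F n)ˣ) B := by
    intro A B
    rw [← conj_iff]
    constructor
    · intro h
      exact (hty A).iso (h ▸ hty B)
    · rintro ⟨e⟩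
      exact ((hty A).congr e).unique (hty B)
  let φ : MulAction.orbitRel.Quotient (ConjAct (En F n)ˣ) (En F n) → Ty F n :=
    Quotient.lift (fun A => (⟨ty A, hasT_wt A (hty A)⟩ : Ty F n)) fun A B h =>
      Subtype.ext ((key A B).2 h)
  refine ⟨Equiv.ofBijective φ ⟨?_, ?_⟩⟩
  · intro x y
    induction x using Quotient.inductionOn with | _ A
    induction y using Quotient.inductionOn with | _ B
    intro h
    exact Quotient.sound ((key A B).1 (congrArg Subtype.val h))
  · rintro ⟨s, hs⟩
    obtain ⟨A, hA⟩ := hasT_real s hs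
    exact ⟨Quotient.mk _ A, Subtype.ext ((hty A).unique hA)⟩

lemma fin_Ty (n : ℕ) : Finite (Ty F n) := by
  have : Finite (En F n) := finite_of_fd (F := F) _
  obtain ⟨e⟩ := orbits_types (F := F) n
  exact Finite.of_equiv _ e

lemma Pnk_burn (n : ℕ) : Pnk F n 0 = Nat.card (Ty F n) * injN (Fintype.card F) n n := by
  have hfin : Finite (En F n) := finite_of_fd (F := F) _
  obtain ⟨e⟩ := orbits_types (F := F) n
  have h1 := Nat.card_congr (MulAction.sigmaFixedByEquivOrbitsProdGroup (ConjAct (En F n)ˣ) (En F n))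
  rw [Nat.card_prod, Nat.card_congr e] at h1
  have h2 : Nat.card (ConjAct (En F n)ˣ) = injN (Fintype.card F) n n := by
    have := card_equivs (F := F) (Fin n → F) (Fin n → F) rfl
    rw [Module.finrank_fin_fun] at this
    rw [← this]
    exact Nat.card_congr (ConjAct.ofConjAct.toEquiv.trans
      (LinearMap.GeneralLinearGroup.generalLinearEquiv F (Fin n → F)).toEquiv)
  rw [← h2, ← h1, Pnk]
  symm
  apply Nat.card_congr
  have hfix : ∀ (g : (En F n)ˣ) (B : En F n), (g : En F n) * B * ↑g⁻¹ = B ↔ (g : En F n) * B = B * g := by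
    intro g B
    exact Units.mul_inv_eq_iff_eq_mul g
  have hunit : ∀ A : En F n, Module.finrank F (LinearMap.range A) + 0 = n ↔ IsUnit A := by
    intro A
    rw [add_zero, LinearMap.isUnit_iff_range_eq_top]
    constructor
    · intro h
      apply Submodule.eq_top_of_finrank_eq
      rw [h]; simp
    · intro h
      rw [h]; simp
  refine Equiv.ofBijective (fun x => ⟨((ConjAct.ofConjAct x.1 : (En F n)ˣ), x.2.1), ?_, ?_⟩) ⟨?_, ?_⟩
  · exact (hfix _ _).1 x.2.2
  · exact (hunit _).2 (Units.isUnit _)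
  · rintro ⟨g, B, hB⟩ ⟨g', B', hB'⟩ h
    simp only [Subtype.mk.injEq, Prod.mk.injEq] at h
    obtain ⟨h1, rfl⟩ := h
    have h1 := Units.ext h1
    have h1 := ConjAct.ofConjAct.injective h1
    subst h1
    rfl
  · rintro ⟨⟨A, B⟩, h1, h2⟩
    obtain ⟨g, rfl⟩ := (hunit A).1 h2
    exact ⟨⟨ConjAct.toConjAct g, B, (hfix g B).2 h1⟩, rfl⟩

end burn
end

section
open Polynomial

section count
set_option linter.unusedSectionVars false
variable {F : Type} [Field F] [Fintype F]

/-- total degree of a multiset of irreducibles -/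
def dgm (a : Multiset (MIr F)) : ℕ := (a.map fun x => x.1.natDegree).sum

/-- total radical degree -/
def dg (s : Multiset (MIr F × ℕ)) : ℕ := (s.map fun x => x.1.1.natDegree).sum

lemma card_dgm (j : ℕ) : Nat.card {a : Multiset (MIr F) // dgm a = j} = Fintype.card F ^ j := by
  classical
  have h0 : Nat.card {p : F[X] // p.Monic ∧ p.natDegree = j} = Fintype.card F ^ j := by
    rw [Nat.card_congr ((monicEquivDegreeLT j).trans (degreeLTEquiv F j).toEquiv)]
    simp
  rw [← h0]
  have hmon : ∀ a : Multiset (MIr F), (a.map Subtype.val).prod.Monic := fun a =>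
    monic_multiset_prod_of_monic a _ fun i _ => i.2.1
  have hdeg : ∀ a : Multiset (MIr F), (a.map Subtype.val).prod.natDegree = dgm a := by
    intro a
    rw [natDegree_multiset_prod_of_monic, Multiset.map_map]
    · rfl
    · intro f hf
      obtain ⟨i, _, rfl⟩ := Multiset.mem_map.1 hf
      exact i.2.1
  apply Nat.card_congr
  refine Equiv.ofBijective (fun a => ⟨(a.1.map Subtype.val).prod, hmon a.1, (hdeg a.1).trans a.2⟩) ⟨?_, ?_⟩
  · rintro ⟨a, ha⟩ ⟨b, hb⟩ h
    have h1 : (a.map Subtype.val).prod = (b.map Subtype.val).prod := congrArg Subtype.val h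
    have h2 : ∀ a : Multiset (MIr F), UniqueFactorizationMonoid.normalizedFactors (a.map Subtype.val).prod =
        a.map Subtype.val := by
      intro a
      rw [UniqueFactorizationMonoid.normalizedFactors_prod_eq, Multiset.map_map]
      · exact Multiset.map_congr rfl fun x _ => x.2.1.normalize_eq_self
      · intro f hf
        obtain ⟨i, _, rfl⟩ := Multiset.mem_map.1 hf
        exact i.2.2
    have h3 := h2 a
    rw [h1, h2 b] at h3
    exact Subtype.ext (Multiset.map_injective Subtype.val_injective h3.symm)
  · rintro ⟨p, hp, hd⟩
    have hne := hp.ne_zero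
    obtain ⟨a, ha⟩ : ∃ a : Multiset (MIr F), a.map Subtype.val = UniqueFactorizationMonoid.normalizedFactors p := by
      have : ∀ x ∈ UniqueFactorizationMonoid.normalizedFactors p, x.Monic ∧ Irreducible x := by
        intro x hx
        have h1 := UniqueFactorizationMonoid.irreducible_of_normalized_factor x hx
        refine ⟨?_, h1⟩
        rw [← UniqueFactorizationMonoid.normalize_normalized_factor x hx]
        exact monic_normalize h1.ne_zero
      exact ⟨(UniqueFactorizationMonoid.normalizedFactors p).pmap Subtype.mk this, by
        rw [Multiset.map_pmap, Multiset.pmap_eq_map]; simp⟩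
    have h4 : (a.map Subtype.val).prod = p := by
      apply eq_of_monic_of_associated (hmon a) hp
      rw [ha]
      exact UniqueFactorizationMonoid.prod_normalizedFactors hne
    refine ⟨⟨a, ?_⟩, Subtype.ext h4⟩
    rw [← hdeg, h4, hd]

lemma filterMap_none_eq {α β : Type} (s : Multiset α) :
    Multiset.filterMap (fun _ => (none : Option β)) s = 0 := by
  induction s using Multiset.induction_on with
  | empty => simp
  | cons x s ih => rw [Multiset.filterMap_cons_none _ _ rfl, ih]

/-- splitting off exponent zero -/
def splitE : Multiset (MIr F) × Multiset (MIr F × ℕ) ≃ Multiset (MIr F × ℕ) where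
  toFun x := x.1.map (fun φ => (φ, 0)) + x.2.map (fun y => (y.1, y.2 + 1))
  invFun s := (s.filterMap (fun y => if y.2 = 0 then some y.1 else none),
    s.filterMap (fun y => if y.2 = 0 then none else some (y.1, y.2 - 1)))
  left_inv := by
    rintro ⟨a, s⟩
    ext1
    · simp only [Multiset.filterMap_add, Multiset.filterMap_map]
      simp [Function.comp_def, Multiset.filterMap_some, filterMap_none_eq]
    · simp only [Multiset.filterMap_add, Multiset.filterMap_map]
      simp [Function.comp_def, Multiset.filterMap_some, filterMap_none_eq]
  right_inv := by
    intro s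
    induction s using Multiset.induction_on with
    | empty => simp
    | cons x s ih =>
      obtain ⟨φ, e⟩ := x
      dsimp only at ih ⊢
      cases e with
      | zero =>
        rw [Multiset.filterMap_cons_some _ _ _ (b := φ) (by simp), Multiset.filterMap_cons_none _ _ (by simp)]
        rw [Multiset.map_cons, Multiset.cons_add, ih]
      | succ e =>
        rw [Multiset.filterMap_cons_none _ _ (by simp), Multiset.filterMap_cons_some _ _ _ (b := (φ, e)) (by simp)]
        rw [Multiset.map_cons, Multiset.add_cons, ih]

lemma dg_split (x : Multiset (MIr F) × Multiset (MIr F × ℕ)) : dg (splitE x) = dg x.2 + dgm x.1 := by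
  simp only [dg, dgm, splitE, Equiv.coe_fn_mk, Multiset.map_add, Multiset.map_map, Multiset.sum_add, Function.comp_def]
  ring

lemma wt_split (x : Multiset (MIr F) × Multiset (MIr F × ℕ)) :
    wt (splitE x) = wt x.2 + (dg x.2 + dgm x.1) := by
  simp only [dg, dgm, wt, splitE, Equiv.coe_fn_mk, Multiset.map_add, Multiset.map_map, Multiset.sum_add, Function.comp_def,
    zero_add, mul_one]
  have : ∀ y : MIr F × ℕ, y.1.1.natDegree * (y.2 + 1 + 1) = y.1.1.natDegree * (y.2 + 1) + y.1.1.natDegree := by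
    intro y; ring
  simp only [this, Multiset.sum_map_add]
  ring

/-- refined number of types -/
noncomputable def cN (F : Type) [Field F] (n k : ℕ) : ℕ :=
  Nat.card {s : Multiset (MIr F × ℕ) // wt s = n ∧ dg s = k}

lemma fin_c (n k : ℕ) : Finite {s : Multiset (MIr F × ℕ) // wt s = n ∧ dg s = k} := by
  have := fin_Ty (F := F) n
  exact Finite.of_injective (fun s => (⟨s.1, s.2.1⟩ : Ty F n)) fun s t h => by
    have h1 : s.1 = t.1 := congrArg (fun z : Ty F n => z.1) h
    exact Subtype.ext h1

lemma cN_rec (m k : ℕ) : cN F (m + k) k =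
    ∑ x ∈ Finset.HasAntidiagonal.antidiagonal k, cN F m x.1 * Fintype.card F ^ x.2 := by
  have hf := fun n k => fin_c (F := F) n k
  have hf2 : ∀ j, Finite {a : Multiset (MIr F) // dgm a = j} := fun j =>
    Nat.finite_of_card_ne_zero (by rw [card_dgm]; exact pow_ne_zero _ Fintype.card_ne_zero)
  rw [← Finset.sum_coe_sort]
  simp_rw [← card_dgm (F := F), cN, ← Nat.card_prod]
  rw [← Nat.card_sigma]
  symm
  apply Nat.card_congr
  refine Equiv.ofBijective (fun y => ⟨splitE (y.2.2.1, y.2.1.1), ?_, ?_⟩) ⟨?_, ?_⟩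
  · obtain ⟨⟨x, hx⟩, ⟨s, hs⟩, ⟨a, ha⟩⟩ := y
    rw [wt_split]
    have := Finset.HasAntidiagonal.mem_antidiagonal.1 hx
    simp only at hs ha ⊢
    omega
  · obtain ⟨⟨x, hx⟩, ⟨s, hs⟩, ⟨a, ha⟩⟩ := y
    rw [dg_split]
    have := Finset.HasAntidiagonal.mem_antidiagonal.1 hx
    simp only at hs ha ⊢
    omega
  · rintro ⟨⟨⟨x1, x2⟩, hx⟩, ⟨s, hs⟩, ⟨a, ha⟩⟩ ⟨⟨⟨y1, y2⟩, hy⟩, ⟨t, ht⟩, ⟨b, hb⟩⟩ h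
    have h1 := splitE.injective (congrArg Subtype.val h)
    simp only [Prod.mk.injEq] at h1
    obtain ⟨rfl, rfl⟩ := h1
    simp only at hs ha ht hb
    obtain ⟨_, rfl⟩ := hs
    obtain ⟨_, rfl⟩ := ht
    subst ha
    subst hb
    rfl
  · rintro ⟨s, hs1, hs2⟩
    obtain ⟨⟨a, t⟩, rfl⟩ := splitE.surjective s
    rw [dg_split] at hs2
    rw [wt_split] at hs1
    dsimp only at hs1 hs2
    exact ⟨⟨⟨(dg t, dgm a), Finset.HasAntidiagonal.mem_antidiagonal.2 hs2⟩, ⟨t, by omega, rfl⟩, ⟨a, rfl⟩⟩, rfl⟩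

lemma dg_le_wt (s : Multiset (MIr F × ℕ)) : dg s ≤ wt s := by
  apply Multiset.sum_map_le_sum_map
  intro x _
  exact Nat.le_mul_of_pos_right _ (by omega)

lemma cN_zero {n k : ℕ} (h : n < k) : cN F n k = 0 := by
  rw [cN]
  have : IsEmpty {s : Multiset (MIr F × ℕ) // wt s = n ∧ dg s = k} := by
    constructor
    rintro ⟨s, h1, h2⟩
    have := dg_le_wt s
    omega
  exact Nat.card_of_isEmpty

lemma dg_eq_zero {s : Multiset (MIr F × ℕ)} (h : dg s = 0) : s = 0 := by
  induction s using Multiset.induction_on with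
  | empty => rfl
  | cons x s _ =>
    rw [dg, Multiset.map_cons, Multiset.sum_cons] at h
    have := x.1.2.2.natDegree_pos
    omega

lemma cN_right_zero (n : ℕ) : cN F n 0 = if n = 0 then 1 else 0 := by
  rw [cN]
  split_ifs with h
  · subst h
    have : Unique {s : Multiset (MIr F × ℕ) // wt s = 0 ∧ dg s = 0} :=
      { default := ⟨0, by simp [wt], by simp [dg]⟩
        uniq := fun s => Subtype.ext (dg_eq_zero s.2.2) }
    exact Nat.card_unique
  · have : IsEmpty {s : Multiset (MIr F × ℕ) // wt s = n ∧ dg s = 0} := by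
      constructor
      rintro ⟨s, h1, h2⟩
      rw [dg_eq_zero h2] at h1
      apply h
      rw [← h1]; simp [wt]
    exact Nat.card_of_isEmpty

lemma cN_sum (n : ℕ) : ∑ k ∈ Finset.range (n + 1), cN F n k = Nat.card (Ty F n) := by
  have hf := fun n k => fin_c (F := F) n k
  rw [← Finset.sum_coe_sort]
  simp_rw [cN]
  rw [← Nat.card_sigma]
  apply Nat.card_congr
  refine Equiv.ofBijective (fun y => ⟨y.2.1, y.2.2.1⟩) ⟨?_, ?_⟩
  · rintro ⟨⟨x, hx⟩, ⟨s, hs⟩⟩ ⟨⟨y, hy⟩, ⟨t, ht⟩⟩ h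
    have h1 : s = t := congrArg Subtype.val h
    subst h1
    simp only at hs ht
    obtain ⟨_, rfl⟩ := hs
    obtain ⟨_, rfl⟩ := ht
    rfl
  · rintro ⟨s, hs⟩
    refine ⟨⟨⟨dg s, ?_⟩, ⟨s, hs, rfl⟩⟩, rfl⟩
    have := dg_le_wt s
    rw [Finset.mem_range]; omega

end count
end

theorem feit_fine
    (q : ℕ) (hq : ∃ p m : ℕ, p.Prime ∧ 0 < m ∧ q = p ^ m)
    (F : Type) [Field F] [Fintype F] (hF : Fintype.card F = q)
    (u : ℝ) (hu : |u| < 1 / q) :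
    Summable (fun n : ℕ => (commPairs F n : ℝ) * u ^ n / glOrder q n) ∧
    Multipliable (fun il : ℕ × ℕ =>
      (1 - u ^ (il.1 + 1) * (q : ℝ) ^ ((1 : ℤ) - il.2))⁻¹) ∧
    ∑' n : ℕ, (commPairs F n : ℝ) * u ^ n / glOrder q n =
      ∏' il : ℕ × ℕ, (1 - u ^ (il.1 + 1) * (q : ℝ) ^ ((1 : ℤ) - il.2))⁻¹ := by
  have hq2 : 2 ≤ q := by
    rw [← hF]; exact Fintype.one_lt_card
  have key := analytic_final hq2 u hu (fun n k => (Pnk F n k : ℝ) / glOrder q n) (fun n k => (cN F n k : ℝ))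
    (fun n k => by have := glOrder_pos hq2 n; positivity)
    (fun n k h => by simp [Pnk_zero F h])
    (fun m k => pnk_rec F hF hq2 m k)
    (fun n k => by positivity)
    (fun n k h => by simp [cN_zero h])
    (fun m k => by
      have := congrArg (fun z : ℕ => (z : ℝ)) (cN_rec (F := F) m k)
      rw [hF] at this
      push_cast at this
      exact this)
    (fun n => by
      have := congrArg (fun z : ℕ => (z : ℝ)) (cN_right_zero (F := F) n)
      push_cast at this
      exact this)
    (fun n => by
      have h1 := glOrder_pos hq2 n
      have h2 := congrArg (fun z : ℕ => (z : ℝ)) (Pnk_burn (F := F) n)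
      have h3 := congrArg (fun z : ℕ => (z : ℝ)) (cN_sum (F := F) n)
      rw [hF] at h2
      push_cast at h2 h3
      rw [injN_self hq2] at h2
      simp only [rowQ, one_pow, mul_one]
      rw [h3, h2]
      field_simp)
  have hfun : (fun n : ℕ => (commPairs F n : ℝ) * u ^ n / glOrder q n) =
      fun n => rowQ (fun n k => (Pnk F n k : ℝ) / glOrder q n) n 1 * u ^ n := by
    funext n
    simp only [rowQ, one_pow, mul_one]
    rw [← Finset.sum_div, ← sum_Pnk F n]
    push_cast
    ring
  rw [hfun]
  exact key
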